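/- arXiv:1410.8438 — 8 statements merged into one kernel-verified Lean document; each statement's English description precedes it below -/
import Mathlib

section
/- For every archimedean lattice-ordered abelian group G with strong unit u there exist an archimedean Riesz space U and an injective lattice-group homomorphism ι : G → U such that (i) ι is essential, (ii) U is the smallest vector sublattice of U containing the image ι(G), and (iii) ι(u) is a strong unit of U. (Existence of the Riesz hull of a semisimple MV-algebra, stated in the equivalent language of archimedean unital lattice-ordered groups and Riesz spaces.) -/
/-- A Riesz hull of a lattice-ordered abelian group `G` with strong unit `u`:
an archimedean Riesz space `U` together with an injective essential lattice-group
homomorphism `ι : G → U` such that `U` is the smallest vector sublattice of `U`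
containing `ι(G)` and `ι u` is a strong unit of `U`. -/
structure RieszHullOf (G : Type) [Lattice G] [AddCommGroup G] (u : G) : Type 1 where
  U : Type
  [latU : Lattice U]
  [grpU : AddCommGroup U]
  [modU : Module ℝ U]
  /-- `U` is a lattice-ordered abelian group. -/
  cov : ∀ a b c : U, a ≤ b → a + c ≤ b + c
  /-- `U` is a Riesz space. -/
  pos : ∀ (r : ℝ) (x : U), 0 ≤ r → 0 ≤ x → 0 ≤ r • x
  /-- `U` is archimedean. -/
  arch : ∀ x y : U, (∀ n : ℕ, n • x ≤ y) → x ≤ 0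
  ι : G → U
  inj : Function.Injective ι
  map_add : ∀ a b : G, ι (a + b) = ι a + ι b
  map_sup : ∀ a b : G, ι (a ⊔ b) = ι a ⊔ ι b
  /-- `ι` is essential. -/
  essential : ∀ b : U, 0 < b → ∃ a : G, 0 < a ∧ ∃ n : ℕ, ι a ≤ n • b
  /-- `U` is the smallest vector sublattice of `U` containing `ι(G)`. -/
  generates : ∀ S : Submodule ℝ U, (∀ a ∈ S, ∀ b ∈ S, a ⊔ b ∈ S) →
      (∀ a ∈ S, ∀ b ∈ S, a ⊓ b ∈ S) → (∀ g : G, ι g ∈ S) → ∀ x : U, x ∈ S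
  /-- `ι u` is a strong unit of `U`. -/
  unit_nonneg : 0 ≤ ι u
  unit_strong : ∀ x : U, ∃ n : ℕ, x ≤ n • ι u

section LatticeOrderedGroup

variable {G : Type*} [Lattice G] [AddCommGroup G]

section Disjoint

variable [IsOrderedAddMonoid G]

lemma inf_nsmul_eq_zero_of_inf_eq_zero {x y : G} (h : x ⊓ y = 0) (n : ℕ) : x ⊓ n • y = 0 := by
  have hx : 0 ≤ x := h ▸ inf_le_left
  have hy : 0 ≤ y := h ▸ inf_le_right
  induction n with
  | zero => simpa using hx
  | succ n ih =>
    refine le_antisymm ?_ (le_inf hx (nsmul_nonneg hy _))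
    have key : x ⊓ (n + 1) • y ≤ x ⊓ n • y + x ⊓ y := by
      rw [add_inf, inf_add, inf_add, succ_nsmul]
      have hny : 0 ≤ n • y := nsmul_nonneg hy n
      refine le_inf (le_inf ?_ ?_) (le_inf ?_ ?_)
      · exact inf_le_left.trans (le_add_of_nonneg_left hx)
      · exact inf_le_left.trans (le_add_of_nonneg_left hny)
      · exact inf_le_left.trans (le_add_of_nonneg_right hy)
      · exact inf_le_right
    simpa [ih, h] using key

lemma nsmul_inf_nsmul_eq_zero_of_inf_eq_zero {x y : G} (h : x ⊓ y = 0) (m n : ℕ) :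
    m • x ⊓ n • y = 0 :=
  inf_nsmul_eq_zero_of_inf_eq_zero
    (by rw [inf_comm]; exact inf_nsmul_eq_zero_of_inf_eq_zero (by rwa [inf_comm]) m) n

end Disjoint

/-- The positive cone of an ℓ-ideal. -/
structure IsPositiveIdeal (I : Set G) : Prop where
  zero_mem : 0 ∈ I
  nonneg : ∀ x ∈ I, 0 ≤ x
  add_mem : ∀ x ∈ I, ∀ y ∈ I, x + y ∈ I
  mem_of_le : ∀ x y, 0 ≤ x → x ≤ y → y ∈ I → x ∈ I

namespace IsPositiveIdeal

variable {I : Set G}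

lemma singleton_zero : IsPositiveIdeal ({0} : Set G) where
  zero_mem := rfl
  nonneg := by rintro x rfl; exact le_rfl
  add_mem := by rintro x rfl y rfl; simp
  mem_of_le := by rintro x y hx hxy rfl; exact le_antisymm hxy hx

lemma nsmul_mem (hI : IsPositiveIdeal I) {x : G} (hx : x ∈ I) (n : ℕ) : n • x ∈ I := by
  induction n with
  | zero => simpa using hI.zero_mem
  | succ n ih => rw [succ_nsmul]; exact hI.add_mem _ ih _ hx

lemma exists_maximal (hI : IsPositiveIdeal I) {u : G} (hu : u ∉ I) :
    ∃ J, I ⊆ J ∧ Maximal (fun J => IsPositiveIdeal J ∧ u ∉ J) J := by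
  refine zorn_subset_nonempty {J | IsPositiveIdeal J ∧ u ∉ J} ?_ I ⟨hI, hu⟩
  rintro c hc hchain ⟨J₀, hJ₀⟩
  refine ⟨⋃₀ c, ⟨⟨⟨J₀, hJ₀, (hc hJ₀).1.zero_mem⟩, ?_, ?_, ?_⟩, ?_⟩,
    fun s hs => Set.subset_sUnion_of_mem hs⟩
  · rintro x ⟨J, hJ, hx⟩
    exact (hc hJ).1.nonneg x hx
  · rintro x ⟨J, hJ, hx⟩ y ⟨K, hK, hy⟩
    rcases hchain.total hJ hK with h | h
    · exact ⟨K, hK, (hc hK).1.add_mem x (h hx) y hy⟩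
    · exact ⟨J, hJ, (hc hJ).1.add_mem x hx y (h hy)⟩
  · rintro x y hx hxy ⟨J, hJ, hy⟩
    exact ⟨J, hJ, (hc hJ).1.mem_of_le x y hx hxy hy⟩
  · rintro ⟨J, hJ, h⟩
    exact (hc hJ).2 h

variable [IsOrderedAddMonoid G]

/-- The positive ideal generated by a positive ideal and a nonnegative element. -/
lemma adjoin (hI : IsPositiveIdeal I) (x : G) :
    IsPositiveIdeal {y | 0 ≤ y ∧ ∃ i ∈ I, ∃ n : ℕ, y ≤ i + n • x} where
  zero_mem := ⟨le_rfl, 0, hI.zero_mem, 0, by simp⟩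
  nonneg y hy := hy.1
  add_mem := by
    rintro y ⟨hy, i, hi, m, hm⟩ z ⟨hz, j, hj, n, hn⟩
    refine ⟨add_nonneg hy hz, i + j, hI.add_mem _ hi _ hj, m + n, ?_⟩
    rw [add_nsmul, add_add_add_comm]
    exact add_le_add hm hn
  mem_of_le := by
    rintro y z hy hyz ⟨_, i, hi, m, hm⟩
    exact ⟨hy, i, hi, m, hyz.trans hm⟩

/-- The ℓ-ideal, as a subgroup, whose positive cone is `I`. -/
def toAddSubgroup (hI : IsPositiveIdeal I) : AddSubgroup G where
  carrier := {x | x⁺ ∈ I ∧ x⁻ ∈ I}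
  zero_mem' := by simpa using hI.zero_mem
  add_mem' := by
    rintro x y ⟨hx, hx'⟩ ⟨hy, hy'⟩
    refine ⟨hI.mem_of_le _ _ (posPart_nonneg _) ?_ (hI.add_mem _ hx _ hy),
      hI.mem_of_le _ _ (negPart_nonneg _) ?_ (hI.add_mem _ hx' _ hy')⟩
    · exact sup_le (add_le_add (le_posPart x) (le_posPart y))
        (add_nonneg (posPart_nonneg x) (posPart_nonneg y))
    · refine sup_le ?_ (add_nonneg (negPart_nonneg x) (negPart_nonneg y))
      rw [neg_add]
      exact add_le_add (neg_le_negPart x) (neg_le_negPart y)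
  neg_mem' := by
    rintro x ⟨hx, hx'⟩
    exact ⟨by simpa using hx', by simpa using hx⟩

lemma mem_toAddSubgroup_of_nonneg (hI : IsPositiveIdeal I) {x : G} (hx : 0 ≤ x) :
    x ∈ hI.toAddSubgroup ↔ x ∈ I := by
  change x⁺ ∈ I ∧ x⁻ ∈ I ↔ _
  rw [posPart_eq_self.2 hx, negPart_eq_zero.2 hx]
  exact and_iff_left hI.zero_mem

/-- The image of the positive cone in the quotient by an ℓ-ideal. -/
def quotientCone (hI : IsPositiveIdeal I) : AddGroupCone (G ⧸ hI.toAddSubgroup) where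
  carrier := {q | ∃ x : G, 0 ≤ x ∧ (x : G ⧸ hI.toAddSubgroup) = q}
  zero_mem' := ⟨0, le_rfl, rfl⟩
  add_mem' := by
    rintro _ _ ⟨x, hx, rfl⟩ ⟨y, hy, rfl⟩
    exact ⟨x + y, add_nonneg hx hy, rfl⟩
  eq_zero_of_mem_of_neg_mem' := by
    rintro _ ⟨x, hx, rfl⟩ ⟨y, hy, hxy⟩
    have h : x + y ∈ hI.toAddSubgroup := by
      rw [← QuotientAddGroup.eq_zero_iff, QuotientAddGroup.mk_add, hxy, add_neg_cancel]
    rw [hI.mem_toAddSubgroup_of_nonneg (add_nonneg hx hy)] at h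
    rw [QuotientAddGroup.eq_zero_iff, hI.mem_toAddSubgroup_of_nonneg hx]
    exact hI.mem_of_le _ _ hx (le_add_of_nonneg_right hy) h

lemma exists_le_add_nsmul_of_maximal {u : G}
    (hI : Maximal (fun J => IsPositiveIdeal J ∧ u ∉ J) I) {x : G} (hx : 0 ≤ x) (hxI : x ∉ I) :
    ∃ i ∈ I, ∃ n : ℕ, u ≤ i + n • x := by
  by_contra h
  refine hxI (hI.2 ⟨hI.1.1.adjoin x, fun h' => h h'.2⟩ ?_
    ⟨hx, 0, hI.1.1.zero_mem, 1, by simp⟩)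
  exact fun y hy => ⟨hI.1.1.nonneg y hy, y, hy, 0, by simp⟩

lemma mem_or_mem_of_maximal {u : G} (hu0 : 0 ≤ u)
    (hI : Maximal (fun J => IsPositiveIdeal J ∧ u ∉ J) I) {x y : G} (hxy : x ⊓ y = 0) :
    x ∈ I ∨ y ∈ I := by
  by_contra! h
  obtain ⟨i, hi, m, hm⟩ :=
    exists_le_add_nsmul_of_maximal hI (hxy ▸ inf_le_left : 0 ≤ x) h.1
  obtain ⟨j, hj, n, hn⟩ :=
    exists_le_add_nsmul_of_maximal hI (hxy ▸ inf_le_right : 0 ≤ y) h.2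
  have hi0 := hI.1.1.nonneg i hi
  have hj0 := hI.1.1.nonneg j hj
  refine hI.1.2 (hI.1.1.mem_of_le u (i + j) hu0 ?_ (hI.1.1.add_mem i hi j hj))
  rw [← sub_nonpos, ← nsmul_inf_nsmul_eq_zero_of_inf_eq_zero hxy m n]
  refine le_inf ?_ ?_
  · rw [sub_le_iff_le_add']
    exact hm.trans (add_le_add_left (le_add_of_nonneg_right hj0) _)
  · rw [sub_le_iff_le_add']
    exact hn.trans (add_le_add_left (le_add_of_nonneg_left hi0) _)

/-- The quotient by a maximal ℓ-ideal embeds in `ℝ`, by Hölder's theorem. -/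
lemma exists_real_hom_of_maximal {u : G} (hu0 : 0 ≤ u) (hu : ∀ x : G, ∃ n : ℕ, x ≤ n • u)
    (hI : Maximal (fun J => IsPositiveIdeal J ∧ u ∉ J) I) :
    ∃ φ : G →+ ℝ, (∀ a b, φ (a ⊔ b) = φ a ⊔ φ b) ∧ φ u = 1 ∧ ∀ x ∈ I, φ x = 0 := by
  classical
  have hP := hI.1.1
  set C := hP.quotientCone with hC
  have : HasMemOrNegMem C := by
    refine ⟨fun q => ?_⟩
    induction q using QuotientAddGroup.induction_on with
    | H z =>
      have hz : (z : G ⧸ hP.toAddSubgroup) =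
          ((z⁺ : G) : G ⧸ hP.toAddSubgroup) - ((z⁻ : G) : G ⧸ hP.toAddSubgroup) := by
        rw [← QuotientAddGroup.mk_sub, posPart_sub_negPart]
      rcases mem_or_mem_of_maximal hu0 hI (posPart_inf_negPart_eq_zero z) with h | h
      · right
        refine ⟨z⁻, negPart_nonneg z, ?_⟩
        rw [← hP.mem_toAddSubgroup_of_nonneg (posPart_nonneg z),
          ← QuotientAddGroup.eq_zero_iff] at h
        rw [hz, h, zero_sub, neg_neg]
      · left
        refine ⟨z⁺, posPart_nonneg z, ?_⟩
        rw [← hP.mem_toAddSubgroup_of_nonneg (negPart_nonneg z),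
          ← QuotientAddGroup.eq_zero_iff] at h
        rw [hz, h, sub_zero]
  let _ : LinearOrder (G ⧸ hP.toAddSubgroup) := LinearOrder.mkOfAddGroupCone C
  have : IsOrderedAddMonoid (G ⧸ hP.toAddSubgroup) := IsOrderedAddMonoid.mkOfCone C
  have mk_mono {x y : G} (h : x ≤ y) :
      (x : G ⧸ hP.toAddSubgroup) ≤ (y : G ⧸ hP.toAddSubgroup) :=
    ⟨y - x, sub_nonneg.2 h, rfl⟩
  have mk_eq_zero {x : G} (h : x ∈ I) : (x : G ⧸ hP.toAddSubgroup) = 0 := by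
    rwa [QuotientAddGroup.eq_zero_iff, hP.mem_toAddSubgroup_of_nonneg (hP.nonneg x h)]
  have : Archimedean (G ⧸ hP.toAddSubgroup) := by
    refine ⟨fun q r hr => ?_⟩
    obtain ⟨x, hx, hxr⟩ : ∃ x : G, 0 ≤ x ∧ (x : G ⧸ hP.toAddSubgroup) = r - 0 := hr.le
    rw [sub_zero] at hxr
    subst hxr
    have hxI : x ∉ I := fun h => hr.ne' (mk_eq_zero h)
    induction q using QuotientAddGroup.induction_on with
    | H z =>
      obtain ⟨i, hi, m, hm⟩ := exists_le_add_nsmul_of_maximal hI hx hxI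
      obtain ⟨k, hk⟩ := hu z
      refine ⟨k * m, ?_⟩
      have h1 := mk_mono (hk.trans (nsmul_le_nsmul_right hm k))
      rw [nsmul_add, QuotientAddGroup.mk_add, mk_eq_zero (hP.nsmul_mem hi k), zero_add,
        ← mul_nsmul'] at h1
      exact h1
  obtain ⟨f, hf⟩ :=
    Archimedean.exists_orderAddMonoidHom_real_injective (G ⧸ hP.toAddSubgroup)
  set ψ : G →+ ℝ := (f : (G ⧸ hP.toAddSubgroup) →+ ℝ).comp
    (QuotientAddGroup.mk' hP.toAddSubgroup) with hψ
  have ψ_mono : Monotone ψ := fun x y h => OrderHomClass.mono f (mk_mono h)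
  have ψ_zero {x : G} (h : x ∈ I) : ψ x = 0 := by
    change f (x : G ⧸ hP.toAddSubgroup) = 0
    rw [mk_eq_zero h, map_zero]
  have ψ_sup (a b : G) : ψ (a ⊔ b) = ψ a ⊔ ψ b := by
    refine le_antisymm ?_ (sup_le (ψ_mono le_sup_left) (ψ_mono le_sup_right))
    rcases mem_or_mem_of_maximal hu0 hI (posPart_inf_negPart_eq_zero (a - b)) with h | h
    · rw [sup_eq_add_posPart_sub, map_add, ψ_zero h, add_zero]
      exact le_sup_right
    · rw [← posPart_neg, neg_sub] at h
      rw [sup_comm a b, sup_eq_add_posPart_sub, map_add, ψ_zero h, add_zero]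
      exact le_sup_left
  have ψ_u : 0 < ψ u := by
    refine lt_of_le_of_ne (by simpa using ψ_mono hu0) fun h => hI.1.2 ?_
    rw [← hP.mem_toAddSubgroup_of_nonneg hu0, ← QuotientAddGroup.eq_zero_iff]
    exact hf (by rw [map_zero]; exact h.symm)
  refine ⟨(AddMonoidHom.mulLeft (ψ u)⁻¹).comp ψ, fun a b => ?_, ?_, fun x hx => ?_⟩
  · change (ψ u)⁻¹ * ψ (a ⊔ b) = (ψ u)⁻¹ * ψ a ⊔ (ψ u)⁻¹ * ψ b
    rw [ψ_sup, mul_max_of_nonneg _ _ (inv_nonneg.2 ψ_u.le)]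
  · exact inv_mul_cancel₀ ψ_u.ne'
  · change (ψ u)⁻¹ * ψ x = 0
    rw [ψ_zero hx, mul_zero]

end IsPositiveIdeal

variable (G) in
/-- The maximal spectrum of `(G, u)`: normalized lattice-group homomorphisms to `ℝ`. -/
def RealPoint (u : G) : Type _ :=
  {φ : G →+ ℝ // (∀ a b, φ (a ⊔ b) = φ a ⊔ φ b) ∧ φ u = 1}

namespace RealPoint

variable {u : G}

instance : FunLike (RealPoint G u) G ℝ where
  coe φ := φ.1
  coe_injective _ _ h := Subtype.ext (DFunLike.coe_injective h)

instance : AddMonoidHomClass (RealPoint G u) G ℝ where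
  map_add φ := φ.1.map_add
  map_zero φ := φ.1.map_zero

lemma map_sup (φ : RealPoint G u) (a b : G) : φ (a ⊔ b) = φ a ⊔ φ b := φ.2.1 a b

lemma map_unit (φ : RealPoint G u) : φ u = 1 := φ.2.2

lemma map_posPart (φ : RealPoint G u) (a : G) : φ a⁺ = φ a ⊔ 0 := by
  rw [posPart_def, map_sup, map_zero]

lemma monotone (φ : RealPoint G u) : Monotone φ := fun a b h => by
  rw [← sup_eq_right.2 h, map_sup]
  exact le_sup_left

instance : TopologicalSpace (RealPoint G u) :=
  TopologicalSpace.generateFrom {s | ∃ a : G, 0 ≤ a ∧ s = {φ | 0 < φ a}}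

lemma isOpen_setOf_pos {a : G} (ha : 0 ≤ a) : IsOpen {φ : RealPoint G u | 0 < φ a} :=
  TopologicalSpace.isOpen_generateFrom_of_mem ⟨a, ha, rfl⟩

lemma isOpen_setOf_lt (g : G) (r : ℝ) : IsOpen {φ : RealPoint G u | r < φ g} := by
  rw [isOpen_iff_forall_mem_open]
  intro φ hφ
  obtain ⟨q, hrq, hqφ⟩ := exists_rat_btwn (show r < φ g from hφ)
  have key (ψ : RealPoint G u) : 0 < ψ (q.den • g - q.num • u)⁺ ↔ (q : ℝ) < ψ g := by
    have hd : (0 : ℝ) < q.den := by exact_mod_cast q.den_pos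
    rw [map_posPart, lt_sup_iff, or_iff_left (lt_irrefl _), map_sub, map_nsmul, map_zsmul,
      map_unit, sub_pos, nsmul_eq_mul, zsmul_eq_mul, mul_one, Rat.cast_def, div_lt_iff₀' hd]
  exact ⟨_, fun ψ hψ => hrq.trans ((key ψ).1 hψ), isOpen_setOf_pos (posPart_nonneg _),
    (key φ).2 hqφ⟩

lemma continuous_eval (g : G) : Continuous fun φ : RealPoint G u => φ g := by
  refine OrderTopology.continuous_iff.2 fun r => ⟨isOpen_setOf_lt g r, ?_⟩
  convert isOpen_setOf_lt (u := u) (-g) (-r) using 1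
  ext φ
  simp

variable [IsOrderedAddMonoid G]

lemma map_inf (φ : RealPoint G u) (a b : G) : φ (a ⊓ b) = φ a ⊓ φ b := by
  rw [← neg_neg (a ⊓ b), neg_inf, map_neg, map_sup, map_neg, map_neg, ← neg_inf, neg_neg]

/-- Real points separate the positive elements of an archimedean group from zero. -/
lemma exists_pos (hu0 : 0 ≤ u) (hu : ∀ x : G, ∃ n : ℕ, x ≤ n • u)
    (hGarch : ∀ x y : G, (∀ n : ℕ, n • x ≤ y) → x ≤ 0) {a : G} (ha : 0 < a) :
    ∃ φ : RealPoint G u, 0 < φ a := by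
  obtain ⟨n, hn⟩ : ∃ n : ℕ, ¬ n • a ≤ u := by
    by_contra! h
    exact ha.not_ge (hGarch a u h)
  have hI := IsPositiveIdeal.singleton_zero.adjoin (n • a - u)⁻
  obtain ⟨J, hIJ, hJ⟩ := hI.exists_maximal (u := u) (by
    rintro ⟨-, i, rfl, m, hm⟩
    rw [zero_add] at hm
    obtain ⟨k, hk⟩ := hu (n • a - u)⁺
    have hle := hk.trans (nsmul_le_nsmul_right hm k)
    rw [← mul_nsmul'] at hle
    have h0 := inf_nsmul_eq_zero_of_inf_eq_zero
      (posPart_inf_negPart_eq_zero (n • a - u)) (k * m)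
    rw [inf_eq_left.2 hle, posPart_eq_zero, sub_nonpos] at h0
    exact hn h0)
  obtain ⟨φ, hφ, hφu, hφJ⟩ := IsPositiveIdeal.exists_real_hom_of_maximal hu0 hu hJ
  let Φ : RealPoint G u := ⟨φ, hφ, hφu⟩
  refine ⟨Φ, ?_⟩
  have h0 : Φ (n • a - u)⁻ = 0 :=
    hφJ _ (hIJ ⟨negPart_nonneg _, 0, rfl, 1, by simp⟩)
  rw [← posPart_neg, map_posPart, map_neg, map_sub, map_unit, map_nsmul, nsmul_eq_mul] at h0
  have h1 : -(n * Φ a - 1) ≤ 0 := h0 ▸ le_sup_left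
  by_contra! h2
  nlinarith [(Nat.cast_nonneg n : (0 : ℝ) ≤ n)]

lemma isTopologicalBasis (hu0 : 0 ≤ u) : TopologicalSpace.IsTopologicalBasis
    {s : Set (RealPoint G u) | ∃ a : G, 0 ≤ a ∧ s = {φ | 0 < φ a}} where
  exists_subset_inter := by
    rintro _ ⟨a, ha, rfl⟩ _ ⟨b, hb, rfl⟩ φ hφ
    refine ⟨_, ⟨a ⊓ b, le_inf ha hb, rfl⟩, ?_, fun ψ hψ => ?_⟩
    · change 0 < φ (a ⊓ b)
      rw [map_inf]
      exact lt_inf_iff.2 hφ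
    · change 0 < ψ (a ⊓ b) at hψ
      rw [map_inf] at hψ
      exact lt_inf_iff.1 hψ
  sUnion_eq := Set.eq_univ_of_forall fun φ =>
    ⟨_, ⟨u, hu0, rfl⟩, by change 0 < φ u; rw [map_unit]; exact one_pos⟩
  eq_generateFrom := rfl

/-- A nonnegative nonzero continuous function dominates, up to a multiple, an element of `G`. -/
lemma exists_le_nsmul (hu0 : 0 ≤ u) (hu : ∀ x : G, ∃ n : ℕ, x ≤ n • u)
    {f : RealPoint G u → ℝ} (hf : Continuous f) (hf0 : 0 ≤ f) {φ : RealPoint G u}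
    (hφ : 0 < f φ) : ∃ a : G, 0 < a ∧ ∃ n : ℕ, ∀ ψ : RealPoint G u, ψ a ≤ n • f ψ := by
  obtain ⟨_, ⟨a, ha, rfl⟩, hφa, hV⟩ := (isTopologicalBasis hu0).exists_subset_of_mem_open
    (show φ ∈ {ψ | f φ / 2 < f ψ} from half_lt_self hφ) (isOpen_lt continuous_const hf)
  obtain ⟨k, hk⟩ := hu a
  obtain ⟨n, hn⟩ := exists_nat_ge (k / (f φ / 2))
  refine ⟨a, lt_of_le_of_ne ha ?_, n, fun ψ => ?_⟩
  · rintro rfl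
    change 0 < φ 0 at hφa
    exact (map_zero φ ▸ hφa).false
  · rw [nsmul_eq_mul]
    rcases le_or_gt (ψ a) 0 with h | h
    · exact h.trans (mul_nonneg (Nat.cast_nonneg n) (hf0 ψ))
    · have h1 : f φ / 2 < f ψ := hV h
      have h2 : ψ a ≤ k := by
        simpa [map_nsmul, map_unit] using ψ.monotone hk
      rw [div_le_iff₀ (half_pos hφ)] at hn
      exact h2.trans (hn.trans (mul_le_mul_of_nonneg_left h1.le (Nat.cast_nonneg n)))

end RealPoint

end LatticeOrderedGroup

/-- The smallest vector sublattice of `X → ℝ` containing `s`. -/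
def vectorSublatticeClosure {X : Type*} (s : Set (X → ℝ)) : Submodule ℝ (X → ℝ) :=
  sInf {S | (∀ a ∈ S, ∀ b ∈ S, a ⊔ b ∈ S) ∧ (∀ a ∈ S, ∀ b ∈ S, a ⊓ b ∈ S) ∧ s ⊆ S}

namespace vectorSublatticeClosure

variable {X : Type*} {s : Set (X → ℝ)}

lemma subset : s ⊆ vectorSublatticeClosure s := fun _ hx =>
  Submodule.mem_sInf.2 fun _ hS => hS.2.2 hx

lemma sup_mem ⦃a b : X → ℝ⦄ (ha : a ∈ vectorSublatticeClosure s)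
    (hb : b ∈ vectorSublatticeClosure s) : a ⊔ b ∈ vectorSublatticeClosure s :=
  Submodule.mem_sInf.2 fun S hS =>
    hS.1 a (Submodule.mem_sInf.1 ha S hS) b (Submodule.mem_sInf.1 hb S hS)

lemma inf_mem ⦃a b : X → ℝ⦄ (ha : a ∈ vectorSublatticeClosure s)
    (hb : b ∈ vectorSublatticeClosure s) : a ⊓ b ∈ vectorSublatticeClosure s :=
  Submodule.mem_sInf.2 fun S hS =>
    hS.2.1 a (Submodule.mem_sInf.1 ha S hS) b (Submodule.mem_sInf.1 hb S hS)

lemma le {S : Submodule ℝ (X → ℝ)} (hsup : ∀ a ∈ S, ∀ b ∈ S, a ⊔ b ∈ S)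
    (hinf : ∀ a ∈ S, ∀ b ∈ S, a ⊓ b ∈ S) (hs : s ⊆ S) : vectorSublatticeClosure s ≤ S :=
  sInf_le ⟨hsup, hinf, hs⟩

lemma continuous [TopologicalSpace X] (hs : ∀ f ∈ s, Continuous f) {f : X → ℝ}
    (hf : f ∈ vectorSublatticeClosure s) : Continuous f :=
  le (S := { carrier := {f | Continuous f}
             add_mem' := fun ha hb => ha.add hb
             zero_mem' := continuous_const
             smul_mem' := fun c _ ha => ha.const_smul c })
    (fun _ ha _ hb => ha.sup hb) (fun _ ha _ hb => ha.inf hb) hs hf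

lemma bounded (hs : ∀ f ∈ s, ∃ C : ℝ, ∀ x, |f x| ≤ C) {f : X → ℝ}
    (hf : f ∈ vectorSublatticeClosure s) : ∃ C : ℝ, ∀ x, |f x| ≤ C := by
  refine le (S := { carrier := {f | ∃ C : ℝ, ∀ x, |f x| ≤ C}
                    add_mem' := ?_
                    zero_mem' := ⟨0, by simp⟩
                    smul_mem' := ?_ }) ?_ ?_ hs hf
  · rintro a b ⟨C, hC⟩ ⟨D, hD⟩
    exact ⟨C + D, fun x => (abs_add_le _ _).trans (add_le_add (hC x) (hD x))⟩
  · rintro c a ⟨C, hC⟩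
    refine ⟨|c| * C, fun x => ?_⟩
    rw [Pi.smul_apply, smul_eq_mul, abs_mul]
    exact mul_le_mul_of_nonneg_left (hC x) (abs_nonneg c)
  · rintro a ⟨C, hC⟩ b ⟨D, hD⟩
    exact ⟨C ⊔ D, fun x => abs_max_le_max_abs_abs.trans (max_le_max (hC x) (hD x))⟩
  · rintro a ⟨C, hC⟩ b ⟨D, hD⟩
    exact ⟨C ⊔ D, fun x => abs_min_le_max_abs_abs.trans (max_le_max (hC x) (hD x))⟩

end vectorSublatticeClosure

/-- Every archimedean lattice-ordered abelian group with strong unit has a Riesz hull. -/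
theorem riesz_hull_exists (G : Type) [Lattice G] [AddCommGroup G]
    (hGcov : ∀ a b c : G, a ≤ b → a + c ≤ b + c)
    (u : G) (hu0 : 0 ≤ u) (hu : ∀ x : G, ∃ n : ℕ, x ≤ n • u)
    (hGarch : ∀ x y : G, (∀ n : ℕ, n • x ≤ y) → x ≤ 0) :
    Nonempty (RieszHullOf G u) := by
  have : IsOrderedAddMonoid G := { add_le_add_left := fun a b h c => hGcov a b c h }
  let e (g : G) : RealPoint G u → ℝ := fun φ => φ g
  let V := vectorSublatticeClosure (Set.range e)
  have he (g : G) : e g ∈ V := vectorSublatticeClosure.subset ⟨g, rfl⟩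
  have hcont {f : RealPoint G u → ℝ} (hf : f ∈ V) : Continuous f :=
    vectorSublatticeClosure.continuous
      (by rintro _ ⟨g, rfl⟩; exact RealPoint.continuous_eval g) hf
  have hbdd {f : RealPoint G u → ℝ} (hf : f ∈ V) : ∃ C : ℝ, ∀ φ, |f φ| ≤ C := by
    refine vectorSublatticeClosure.bounded ?_ hf
    rintro _ ⟨g, rfl⟩
    obtain ⟨n, hn⟩ := hu |g|
    refine ⟨n, fun φ => ?_⟩
    have h1 := φ.monotone hn
    rw [abs, φ.map_sup, map_neg, map_nsmul, φ.map_unit, nsmul_eq_mul, mul_one] at h1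
    exact h1
  have hle {a b : G} (hab : e a ≤ e b) : a ≤ b := by
    rw [← sub_nonpos, ← posPart_eq_zero]
    by_contra hne
    obtain ⟨φ, hφ⟩ := RealPoint.exists_pos hu0 hu hGarch
      (lt_of_le_of_ne (posPart_nonneg (a - b)) (Ne.symm hne))
    rw [φ.map_posPart, map_sub, sup_eq_right.2 (sub_nonpos.2 (hab φ))] at hφ
    exact hφ.false
  exact ⟨{
    U := V
    latU := Subtype.lattice vectorSublatticeClosure.sup_mem vectorSublatticeClosure.inf_mem
    cov := fun a b c h φ => add_le_add_left (h φ) (c.1 φ)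
    pos := fun r x hr hx φ => mul_nonneg hr (hx φ)
    arch := fun x y h φ => by
      by_contra! hx
      obtain ⟨n, hn⟩ := Archimedean.arch (y.1 φ + 1) hx
      have h1 : n • x.1 φ ≤ y.1 φ := h n φ
      linarith
    ι := fun g => ⟨e g, he g⟩
    inj := fun a b hab => by
      have h : e a = e b := congrArg Subtype.val hab
      exact le_antisymm (hle h.le) (hle h.ge)
    map_add := fun a b => Subtype.ext (funext fun φ => map_add φ a b)
    map_sup := fun a b => Subtype.ext (funext fun φ => φ.map_sup a b)
    essential := fun b hb => by
      have hb0 : 0 ≤ b.1 := hb.le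
      obtain ⟨φ, hφ⟩ : ∃ φ, 0 < b.1 φ := by
        by_contra! h
        exact hb.not_ge h
      exact RealPoint.exists_le_nsmul hu0 hu (hcont b.2) hb0 hφ
    generates := fun S hsup hinf hS x => by
      have hVS : V ≤ S.map V.subtype := by
        refine vectorSublatticeClosure.le ?_ ?_ ?_
        · rintro _ ⟨a, ha, rfl⟩ _ ⟨b, hb, rfl⟩
          exact ⟨_, hsup a ha b hb, rfl⟩
        · rintro _ ⟨a, ha, rfl⟩ _ ⟨b, hb, rfl⟩
          exact ⟨_, hinf a ha b hb, rfl⟩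
        · rintro _ ⟨g, rfl⟩
          exact ⟨_, hS g, rfl⟩
      obtain ⟨y, hy, hyx⟩ := hVS x.2
      exact Subtype.ext hyx ▸ hy
    unit_nonneg := fun φ => by
      change 0 ≤ φ u
      rw [φ.map_unit]
      exact zero_le_one
    unit_strong := fun x => by
      obtain ⟨C, hC⟩ := hbdd x.2
      obtain ⟨n, hn⟩ := exists_nat_ge C
      refine ⟨n, fun φ => ?_⟩
      change x.1 φ ≤ n • φ u
      rw [φ.map_unit, nsmul_eq_mul, mul_one]
      exact (le_abs_self _).trans ((hC φ).trans hn) }⟩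
end

section
/- Let G be an archimedean lattice-ordered abelian group with strong unit u, let U be an archimedean Riesz space, and let ι : G → U be an injective essential lattice-group homomorphism such that U is the smallest vector sublattice of U containing ι(G). Then for every archimedean Riesz space V with strong unit v and every lattice-group homomorphism f : G → V with f(u) = v there exists a unique lattice-group homomorphism f_R : U → V with f_R ∘ ι = f; moreover f_R is ℝ-linear, and if f is injective then f_R is injective. (Universal property of the Riesz hull.) -/
theorem floor_smul_le_nsmul_smul_le {E : Type*} [Lattice E] [AddCommGroup E]
    [Module ℝ E] [IsOrderedModule ℝ E] (r : ℝ) {x : E} (hx : 0 ≤ x) (n : ℕ) :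
    ⌊n * r⌋ • x ≤ n • r • x ∧ n • r • x ≤ (⌊n * r⌋ + 1) • x := by
  rw [← Nat.cast_smul_eq_nsmul ℝ, ← Int.cast_smul_eq_zsmul ℝ, ← Int.cast_smul_eq_zsmul ℝ,
    smul_smul]
  refine ⟨smul_le_smul_of_nonneg_right (Int.floor_le _) hx,
    smul_le_smul_of_nonneg_right ?_ hx⟩
  push_cast
  exact (Int.lt_floor_add_one _).le

theorem eq_zero_of_lattice_abs_nonpos {E : Type*} [Lattice E] [AddCommGroup E]
    [IsOrderedAddMonoid E] {x : E} (h : |x| ≤ 0) : x = 0 :=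
  le_antisymm ((le_abs_self x).trans h) (neg_nonpos.1 ((neg_le_abs x).trans h))

/-- A lattice-group homomorphism: an additive map preserving binary suprema. -/
structure IsLatticeGroupHom {A B : Type*} [Lattice A] [AddCommGroup A] [Lattice B]
    [AddCommGroup B] (f : A → B) : Prop where
  map_add : ∀ a b, f (a + b) = f a + f b
  map_sup : ∀ a b, f (a ⊔ b) = f a ⊔ f b

namespace IsLatticeGroupHom

variable {A B : Type*} [Lattice A] [AddCommGroup A] [Lattice B] [AddCommGroup B] {f : A → B}

theorem map_zero (hf : IsLatticeGroupHom f) : f 0 = 0 := by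
  simpa using hf.map_add 0 0

theorem map_neg (hf : IsLatticeGroupHom f) (a : A) : f (-a) = -f a := by
  rw [eq_neg_iff_add_eq_zero, ← hf.map_add, neg_add_cancel, hf.map_zero]

theorem map_sub (hf : IsLatticeGroupHom f) (a b : A) : f (a - b) = f a - f b := by
  rw [sub_eq_add_neg, hf.map_add, hf.map_neg, sub_eq_add_neg]

theorem map_nsmul (hf : IsLatticeGroupHom f) (n : ℕ) (a : A) : f (n • a) = n • f a :=
  _root_.map_nsmul (AddMonoidHom.mk' f hf.map_add) n a

theorem map_zsmul (hf : IsLatticeGroupHom f) (n : ℤ) (a : A) : f (n • a) = n • f a :=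
  _root_.map_zsmul (AddMonoidHom.mk' f hf.map_add) n a

theorem monotone (hf : IsLatticeGroupHom f) : Monotone f := fun a b hab => by
  rw [← sup_eq_right, ← hf.map_sup, sup_eq_right.2 hab]

theorem map_nonneg (hf : IsLatticeGroupHom f) {a : A} (ha : 0 ≤ a) : 0 ≤ f a :=
  hf.map_zero ▸ hf.monotone ha

theorem map_negPart (hf : IsLatticeGroupHom f) (a : A) : f a⁻ = (f a)⁻ := by
  rw [negPart_def, hf.map_sup, hf.map_zero, hf.map_neg, negPart_def]

theorem map_abs (hf : IsLatticeGroupHom f) (a : A) : f |a| = |f a| := by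
  rw [abs, hf.map_sup, hf.map_neg, abs]

theorem map_inf [IsOrderedAddMonoid A] [IsOrderedAddMonoid B] (hf : IsLatticeGroupHom f)
    (a b : A) : f (a ⊓ b) = f a ⊓ f b := by
  rw [← neg_inj, ← hf.map_neg, neg_inf, neg_inf, hf.map_sup, hf.map_neg, hf.map_neg]

theorem comp {C : Type*} [Lattice C] [AddCommGroup C] {g : B → C} (hg : IsLatticeGroupHom g)
    (hf : IsLatticeGroupHom f) : IsLatticeGroupHom (g ∘ f) where
  map_add a b := by simp [hf.map_add, hg.map_add]
  map_sup a b := by simp [hf.map_sup, hg.map_sup]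

/-- A lattice-group homomorphism into an archimedean Riesz space is real-linear. -/
theorem map_smul [IsOrderedAddMonoid A] [IsOrderedAddMonoid B] [Module ℝ A] [Module ℝ B]
    [IsOrderedModule ℝ A] [IsOrderedModule ℝ B]
    (hB : ∀ x y : B, (∀ n : ℕ, n • x ≤ y) → x ≤ 0)
    (hf : IsLatticeGroupHom f) (r : ℝ) (a : A) : f (r • a) = r • f a := by
  have hpos : ∀ x : A, 0 ≤ x → f (r • x) = r • f x := by
    intro x hx
    have h1 : ∀ n : ℕ, ⌊n * r⌋ • f x ≤ n • f (r • x) ∧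
        n • f (r • x) ≤ ⌊n * r⌋ • f x + f x := by
      intro n
      have h := floor_smul_le_nsmul_smul_le r hx n
      have h' := And.intro (hf.monotone h.1) (hf.monotone h.2)
      rwa [hf.map_nsmul, hf.map_zsmul, hf.map_zsmul, add_smul, one_smul] at h'
    have h2 : ∀ n : ℕ, ⌊n * r⌋ • f x ≤ n • r • f x ∧
        n • r • f x ≤ ⌊n * r⌋ • f x + f x := by
      intro n
      have h := floor_smul_le_nsmul_smul_le r (hf.map_nonneg hx) n
      rwa [add_smul, one_smul] at h
    apply le_antisymm
    · rw [← sub_nonpos]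
      refine hB _ (f x) fun n => ?_
      rw [nsmul_sub, sub_le_iff_le_add, add_comm]
      exact (h1 n).2.trans (by gcongr; exact (h2 n).1)
    · rw [← sub_nonpos]
      refine hB _ (f x) fun n => ?_
      rw [nsmul_sub, sub_le_iff_le_add, add_comm]
      exact (h2 n).2.trans (by gcongr; exact (h1 n).1)
  rw [← posPart_sub_negPart a, smul_sub, hf.map_sub, hf.map_sub, smul_sub,
    hpos _ (posPart_nonneg a), hpos _ (negPart_nonneg a)]

end IsLatticeGroupHom

theorem Real.nonpos_of_forall_nsmul_le (x y : ℝ) (h : ∀ n : ℕ, n • x ≤ y) : x ≤ 0 := by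
  by_contra! hx
  obtain ⟨n, hn⟩ := exists_nat_gt (y / x)
  have := h n
  rw [div_lt_iff₀ hx] at hn
  rw [nsmul_eq_mul] at this
  linarith

theorem isOrderedAddMonoid_of_add_le_add {A : Type*} [Lattice A] [AddCommGroup A]
    (h : ∀ a b c : A, a ≤ b → a + c ≤ b + c) : IsOrderedAddMonoid A where
  add_le_add_left a b hab c := h a b c hab

theorem isOrderedModule_of_smul_nonneg {A : Type*} [Lattice A] [AddCommGroup A]
    [IsOrderedAddMonoid A] [Module ℝ A]
    (h : ∀ (r : ℝ) (x : A), 0 ≤ r → 0 ≤ x → 0 ≤ r • x) : IsOrderedModule ℝ A where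
  smul_le_smul_of_nonneg_left r hr a b hab := by
    rw [← sub_nonneg, ← smul_sub]
    exact h _ _ hr (sub_nonneg.2 hab)
  smul_le_smul_of_nonneg_right a ha r s hrs := by
    rw [← sub_nonneg, ← sub_smul]
    exact h _ _ (sub_nonneg.2 hrs) ha

section RealHom

variable {E : Type*} [Lattice E] [AddCommGroup E] [IsOrderedAddMonoid E] [Module ℝ E]
  [IsOrderedModule ℝ E] {e : E}

theorem nonpos_of_le_nsmul_posPart_of_le_nsmul_negPart {x z : E} {n m : ℕ}
    (h₁ : z ≤ n • x⁺) (h₂ : z ≤ m • x⁻) : z ≤ 0 := by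
  have hN : (0 : ℝ) < (n + m + 1 : ℕ) := by positivity
  have h₁' : z ≤ ((n + m + 1 : ℕ) : ℝ) • x⁺ := by
    rw [Nat.cast_smul_eq_nsmul]
    exact h₁.trans (nsmul_le_nsmul_left (posPart_nonneg x) (by omega))
  have h₂' : z ≤ ((n + m + 1 : ℕ) : ℝ) • x⁻ := by
    rw [Nat.cast_smul_eq_nsmul]
    exact h₂.trans (nsmul_le_nsmul_left (negPart_nonneg x) (by omega))
  rw [← inv_smul_le_iff_of_pos hN] at h₁' h₂'
  have h := le_inf h₁' h₂'
  rwa [posPart_inf_negPart_eq_zero, inv_smul_le_iff_of_pos hN, smul_zero] at h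

/-- A cone of nonnegative elements not dominating `e` extends to a prime one. -/
theorem exists_prime_addSubmonoid (I : AddSubmonoid E) (hI : ∀ b ∈ I, 0 ≤ b ∧ ¬ e ≤ b) :
    ∃ J : AddSubmonoid E, I ≤ J ∧ (∀ b ∈ J, 0 ≤ b ∧ ¬ e ≤ b) ∧ ∀ x : E, x⁺ ∈ J ∨ x⁻ ∈ J := by
  obtain ⟨J, hIJ, hJ⟩ := zorn_le_nonempty₀
    {J : AddSubmonoid E | ∀ b ∈ J, 0 ≤ b ∧ ¬ e ≤ b} (by
      intro c hc hchain y hy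
      refine ⟨sSup c, fun b hb => ?_, fun z hz => le_sSup hz⟩
      rw [AddSubmonoid.mem_sSup_of_directedOn ⟨y, hy⟩ hchain.directedOn] at hb
      obtain ⟨s, hs, hbs⟩ := hb
      exact hc hs b hbs) I hI
  have key : ∀ a : E, 0 ≤ a → a ∉ J → ∃ b ∈ J, ∃ n : ℕ, e ≤ b + n • a := by
    intro a ha haJ
    by_contra! hcon
    have hle : J ⊔ AddSubmonoid.multiples a ≤ J := by
      refine hJ.2 (fun b hb => ?_) le_sup_left
      obtain ⟨c, hc, d, ⟨n, rfl⟩, rfl⟩ := AddSubmonoid.mem_sup.1 hb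
      exact ⟨add_nonneg (hJ.1 c hc).1 (nsmul_nonneg ha n), hcon c hc n⟩
    exact haJ (hle (le_sup_right (a := J) (AddSubmonoid.mem_multiples a)))
  refine ⟨J, hIJ, hJ.1, fun x => ?_⟩
  by_contra! hx
  obtain ⟨c, hc, n, hn⟩ := key _ (posPart_nonneg x) hx.1
  obtain ⟨d, hd, m, hm⟩ := key _ (negPart_nonneg x) hx.2
  have hz : e - (c + d) ≤ 0 := by
    apply nonpos_of_le_nsmul_posPart_of_le_nsmul_negPart (x := x) (n := n) (m := m)
    · rw [sub_le_iff_le_add']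
      exact hn.trans (by gcongr; exact le_add_of_nonneg_right (hJ.1 d hd).1)
    · rw [sub_le_iff_le_add']
      exact hm.trans (by gcongr; exact le_add_of_nonneg_left (hJ.1 c hc).1)
  exact (hJ.1 _ (J.add_mem hc hd)).2 (sub_nonpos.1 hz)

/-- A cone of nonnegative elements not dominating the strong unit `e` is killed by a
real-valued lattice-group homomorphism normalized at `e`. -/
theorem exists_isLatticeGroupHom_real (he : 0 ≤ e) (hE : ∀ x : E, ∃ n : ℕ, x ≤ n • e)
    (I : AddSubmonoid E) (hI : ∀ b ∈ I, 0 ≤ b ∧ ¬ e ≤ b) :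
    ∃ φ : E → ℝ, IsLatticeGroupHom φ ∧ φ e = 1 ∧ ∀ b ∈ I, φ b = 0 := by
  obtain ⟨J, hIJ, hJ, hprime⟩ := exists_prime_addSubmonoid I hI
  let R : E → E → Prop := fun x y => ∃ b ∈ J, x ≤ y + b
  have R_of_le : ∀ {x y}, x ≤ y → R x y := fun h => ⟨0, J.zero_mem, by simpa using h⟩
  have R_trans : ∀ {x y z}, R x y → R y z → R x z := by
    rintro x y z ⟨b, hb, h⟩ ⟨c, hc, h'⟩
    refine ⟨c + b, J.add_mem hc hb, h.trans ?_⟩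
    rw [← add_assoc]
    gcongr
  have R_add : ∀ {x y z w}, R x y → R z w → R (x + z) (y + w) := by
    rintro x y z w ⟨b, hb, h⟩ ⟨c, hc, h'⟩
    exact ⟨b + c, J.add_mem hb hc, (add_le_add h h').trans_eq (by abel)⟩
  have R_total : ∀ x y, R x y ∨ R y x := by
    intro x y
    rcases hprime (x - y) with h | h
    · exact Or.inl ⟨_, h, sub_le_iff_le_add'.1 (le_posPart _)⟩
    · refine Or.inr ⟨_, h, ?_⟩
      have := neg_le_negPart (x - y)
      rw [neg_sub] at this
      exact sub_le_iff_le_add'.1 this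
  have R_smul : ∀ {r s : ℝ}, R (r • e) (s • e) → r ≤ s := by
    rintro r s ⟨b, hb, h⟩
    by_contra! hrs
    obtain ⟨n, hn⟩ := exists_nat_gt (r - s)⁻¹
    have hd : 0 < r - s := sub_pos.2 hrs
    have h1 : (1 : ℝ) ≤ n * (r - s) := by
      rw [inv_lt_iff_one_lt_mul₀ hd] at hn
      linarith
    have h2 : (r - s) • e ≤ b := by
      rw [sub_smul]
      exact sub_le_iff_le_add'.2 h
    refine (hJ _ (J.nsmul_mem hb n)).2 ?_
    calc e = (1 : ℝ) • e := (one_smul _ _).symm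
      _ ≤ (n * (r - s)) • e := smul_le_smul_of_nonneg_right h1 he
      _ = n • (r - s) • e := by rw [mul_smul, Nat.cast_smul_eq_nsmul]
      _ ≤ n • b := nsmul_le_nsmul_right h2 n
  let S : E → Set ℝ := fun x => {r | R x (r • e)}
  let φ : E → ℝ := fun x => sInf (S x)
  have S_nonempty : ∀ x, (S x).Nonempty := fun x => by
    obtain ⟨n, hn⟩ := hE x
    exact ⟨n, R_of_le (by rwa [Nat.cast_smul_eq_nsmul])⟩
  have S_lower : ∀ {x r}, R (r • e) x → r ∈ lowerBounds (S x) :=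
    fun h s hs => R_smul (R_trans h hs)
  have S_bdd : ∀ x, BddBelow (S x) := fun x => by
    obtain ⟨n, hn⟩ := hE (-x)
    refine ⟨-n, S_lower (R_of_le ?_)⟩
    rw [neg_smul, Nat.cast_smul_eq_nsmul]
    exact neg_le.1 hn
  have φ_le : ∀ {x r}, R x (r • e) → φ x ≤ r := fun h => csInf_le (S_bdd _) h
  have le_φ : ∀ {x r}, R (r • e) x → r ≤ φ x := fun h => le_csInf (S_nonempty _) (S_lower h)
  have R_of_lt : ∀ {x r}, φ x < r → R x (r • e) := fun {x r} h =>
    (R_total x (r • e)).resolve_right fun h' => (le_φ h').not_gt h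
  have R_of_gt : ∀ {x r}, r < φ x → R (r • e) x := fun {x r} h =>
    (R_total x (r • e)).resolve_left fun h' => (φ_le h').not_gt h
  have φ_mono : ∀ {x y}, R x y → φ x ≤ φ y := fun h =>
    le_of_forall_gt_imp_ge_of_dense fun r hr => φ_le (R_trans h (R_of_lt hr))
  refine ⟨φ, ⟨fun x y => le_antisymm ?_ ?_, fun x y => ?_⟩, le_antisymm ?_ ?_, fun b hb =>
    le_antisymm ?_ ?_⟩
  · refine le_of_forall_pos_le_add fun ε hε => φ_le ?_
    have := R_add (R_of_lt (x := x) (lt_add_of_pos_right _ (half_pos hε)))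
      (R_of_lt (x := y) (lt_add_of_pos_right _ (half_pos hε)))
    rw [← add_smul] at this
    convert this using 2
    ring
  · refine le_of_forall_pos_le_add fun ε hε => sub_le_iff_le_add.1 (le_φ ?_)
    have := R_add (R_of_gt (x := x) (sub_lt_self _ (half_pos hε)))
      (R_of_gt (x := y) (sub_lt_self _ (half_pos hε)))
    rw [← add_smul] at this
    convert this using 2
    ring
  · have hsup : ∀ {x y}, R x y → φ (x ⊔ y) = φ y := by
      rintro x y ⟨b, hb, h⟩
      exact le_antisymm
        (φ_mono ⟨b, hb, sup_le h (le_add_of_nonneg_right (hJ b hb).1)⟩)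
        (φ_mono (R_of_le le_sup_right))
    rcases R_total x y with h | h
    · rw [hsup h, sup_eq_right.2 (φ_mono h)]
    · rw [sup_comm, hsup h, sup_eq_left.2 (φ_mono h)]
  · exact φ_le (R_of_le (one_smul ℝ e).ge)
  · exact le_φ (R_of_le (one_smul ℝ e).le)
  · exact φ_le ⟨b, hIJ hb, by simp⟩
  · exact le_φ (R_of_le (by simpa using (hI b hb).1))

/-- Normalized real-valued lattice-group homomorphisms separate the points of an archimedean
Riesz space with strong unit. -/
theorem eq_zero_of_forall_isLatticeGroupHom_real
    (hE_arch : ∀ x y : E, (∀ n : ℕ, n • x ≤ y) → x ≤ 0)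
    (he : 0 ≤ e) (hE : ∀ x : E, ∃ n : ℕ, x ≤ n • e) (y : E)
    (hy : ∀ φ : E → ℝ, IsLatticeGroupHom φ → φ e = 1 → φ y = 0) : y = 0 := by
  refine eq_zero_of_lattice_abs_nonpos (hE_arch _ e fun n => ?_)
  set x := n • |y| - e with hx
  by_contra hlt
  obtain ⟨φ, hφ, hφe, hφI⟩ := exists_isLatticeGroupHom_real he hE
    (AddSubmonoid.multiples x⁻) (by
      rintro _ ⟨m, rfl⟩
      refine ⟨nsmul_nonneg (negPart_nonneg x) m, fun h => hlt ?_⟩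
      obtain ⟨k, hk⟩ := hE x⁺
      have h0 : x⁺ ≤ 0 := nonpos_of_le_nsmul_posPart_of_le_nsmul_negPart
        (x := x) (n := 1) (m := k * m) (one_nsmul _).ge
        (hk.trans ((nsmul_le_nsmul_right h k).trans_eq (by simp [mul_nsmul'])))
      exact sub_nonpos.1 ((le_posPart x).trans h0))
  have h1 : φ x = -1 := by
    rw [hx, hφ.map_sub, hφ.map_nsmul, hφ.map_abs, hy φ hφ hφe, hφe]
    simp
  have h2 := hφI _ (AddSubmonoid.mem_multiples x⁻)
  rw [hφ.map_negPart, negPart_eq_zero, h1] at h2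
  norm_num at h2

/-- A real-valued lattice-group homomorphism normalized at `u` extends along an injective
lattice-group homomorphism sending `u` to a strong unit. -/
theorem exists_extension_isLatticeGroupHom_real {G : Type*} [Lattice G] [AddCommGroup G]
    [IsOrderedAddMonoid G] {u : G} {ι : G → E} (hι : IsLatticeGroupHom ι)
    (hι_inj : Function.Injective ι) (hu : 0 ≤ u) (hE : ∀ x : E, ∃ n : ℕ, x ≤ n • ι u)
    {h : G → ℝ} (hh : IsLatticeGroupHom h) (hhu : h u = 1) :
    ∃ φ : E → ℝ, IsLatticeGroupHom φ ∧ ∀ g, φ (ι g) = h g := by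
  let I : AddSubmonoid E :=
    { carrier := {x | ∃ g, 0 ≤ g ∧ h g = 0 ∧ ι g = x}
      zero_mem' := ⟨0, le_rfl, hh.map_zero, hι.map_zero⟩
      add_mem' := by
        rintro _ _ ⟨a, ha, ha', rfl⟩ ⟨b, hb, hb', rfl⟩
        exact ⟨a + b, add_nonneg ha hb, by rw [hh.map_add, ha', hb', add_zero], hι.map_add a b⟩ }
  obtain ⟨φ, hφ, hφu, hφI⟩ := exists_isLatticeGroupHom_real (hι.map_nonneg hu) hE I (by
    rintro _ ⟨g, hg, hg0, rfl⟩
    refine ⟨hι.map_nonneg hg, fun hle => ?_⟩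
    have hug : u ≤ g := by
      rw [← sup_eq_right] at hle ⊢
      exact hι_inj (by rw [hι.map_sup, hle])
    have := hh.monotone hug
    rw [hhu, hg0] at this
    norm_num at this)
  have hker : ∀ g, 0 ≤ h g → 0 ≤ φ (ι g) := by
    intro g hg
    have h1 : φ (ι g⁻) = 0 := hφI _ ⟨g⁻, negPart_nonneg g, by
      rw [hh.map_negPart, negPart_eq_zero.2 hg], rfl⟩
    rwa [hι.map_negPart, hφ.map_negPart, negPart_eq_zero] at h1
  have hle : ∀ g, h g ≤ φ (ι g) := by
    intro g
    rw [← sub_nonpos]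
    refine Real.nonpos_of_forall_nsmul_le _ 1 fun n => ?_
    have h1 := hker (n • g - ⌊n * h g⌋ • u) (by
      rw [hh.map_sub, hh.map_nsmul, hh.map_zsmul, hhu]
      simp)
    rw [hι.map_sub, hφ.map_sub, hι.map_nsmul, hι.map_zsmul,
      hφ.map_nsmul, hφ.map_zsmul, hφu] at h1
    simp only [nsmul_eq_mul, zsmul_eq_mul, mul_one] at h1 ⊢
    have h2 := Int.lt_floor_add_one (n * h g)
    linarith
  refine ⟨φ, hφ, fun g => le_antisymm ?_ (hle g)⟩
  have := hle (-g)
  rwa [hh.map_neg, hι.map_neg, hφ.map_neg, neg_le_neg_iff] at this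

end RealHom

/-- Universal property of the Riesz hull: if `ι : G → U` is an injective essential
lattice-group homomorphism of an archimedean lattice-ordered abelian group `G` with
strong unit `u` into an archimedean Riesz space `U` generated (as a vector sublattice)
by `ι(G)`, then every lattice-group homomorphism `f : G → V` into an archimedean Riesz
space with strong unit `v` satisfying `f u = v` extends uniquely to a lattice-group
homomorphism `f_R : U → V`; moreover `f_R` is `ℝ`-linear, and injective whenever `f` is. -/
theorem riesz_hull_universal_property
    (G : Type) [Lattice G] [AddCommGroup G]
    (hGcov : ∀ a b c : G, a ≤ b → a + c ≤ b + c)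
    (hGarch : ∀ x y : G, (∀ n : ℕ, n • x ≤ y) → x ≤ 0)
    (u : G) (hu0 : 0 ≤ u) (hu : ∀ x : G, ∃ n : ℕ, x ≤ n • u)
    (U : Type) [Lattice U] [AddCommGroup U] [Module ℝ U]
    (hUcov : ∀ a b c : U, a ≤ b → a + c ≤ b + c)
    (hUpos : ∀ (r : ℝ) (x : U), 0 ≤ r → 0 ≤ x → 0 ≤ r • x)
    (hUarch : ∀ x y : U, (∀ n : ℕ, n • x ≤ y) → x ≤ 0)
    (ι : G → U) (hι_inj : Function.Injective ι)
    (hι_add : ∀ a b : G, ι (a + b) = ι a + ι b)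
    (hι_sup : ∀ a b : G, ι (a ⊔ b) = ι a ⊔ ι b)
    (hι_ess : ∀ b : U, 0 < b → ∃ a : G, 0 < a ∧ ∃ n : ℕ, ι a ≤ n • b)
    (hι_gen : ∀ S : Submodule ℝ U, (∀ a ∈ S, ∀ b ∈ S, a ⊔ b ∈ S) →
      (∀ a ∈ S, ∀ b ∈ S, a ⊓ b ∈ S) → (∀ g : G, ι g ∈ S) → ∀ x : U, x ∈ S)
    (V : Type) [Lattice V] [AddCommGroup V] [Module ℝ V]
    (hVcov : ∀ a b c : V, a ≤ b → a + c ≤ b + c)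
    (hVpos : ∀ (r : ℝ) (x : V), 0 ≤ r → 0 ≤ x → 0 ≤ r • x)
    (hVarch : ∀ x y : V, (∀ n : ℕ, n • x ≤ y) → x ≤ 0)
    (v : V) (hv0 : 0 ≤ v) (hv : ∀ x : V, ∃ n : ℕ, x ≤ n • v)
    (f : G → V)
    (hf_add : ∀ a b : G, f (a + b) = f a + f b)
    (hf_sup : ∀ a b : G, f (a ⊔ b) = f a ⊔ f b)
    (hfu : f u = v) :
    ∃ fR : U → V,
      (∀ a b : U, fR (a + b) = fR a + fR b) ∧
      (∀ a b : U, fR (a ⊔ b) = fR a ⊔ fR b) ∧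
      (∀ g : G, fR (ι g) = f g) ∧
      (∀ (r : ℝ) (x : U), fR (r • x) = r • fR x) ∧
      (Function.Injective f → Function.Injective fR) ∧
      (∀ g' : U → V, (∀ a b : U, g' (a + b) = g' a + g' b) →
        (∀ a b : U, g' (a ⊔ b) = g' a ⊔ g' b) →
        (∀ a : G, g' (ι a) = f a) → g' = fR) := by
  have := isOrderedAddMonoid_of_add_le_add hGcov
  have := isOrderedAddMonoid_of_add_le_add hUcov
  have := isOrderedAddMonoid_of_add_le_add hVcov
  have := isOrderedModule_of_smul_nonneg hUpos
  have := isOrderedModule_of_smul_nonneg hVpos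
  have hι : IsLatticeGroupHom ι := ⟨hι_add, hι_sup⟩
  have hf : IsLatticeGroupHom f := ⟨hf_add, hf_sup⟩
  have hιu : 0 ≤ ι u := hι.map_nonneg hu0
  have hU : ∀ x : U, ∃ n : ℕ, x ≤ n • ι u := by
    let S : Submodule ℝ U :=
      { carrier := {x | ∃ c : ℝ, |x| ≤ c • ι u}
        zero_mem' := ⟨0, by simp⟩
        add_mem' := by
          rintro x y ⟨c, hc⟩ ⟨d, hd⟩
          exact ⟨c + d, (abs_add_le x y).trans (by rw [add_smul]; gcongr)⟩
        smul_mem' := by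
          rintro r x ⟨c, hc⟩
          refine ⟨|r| * c, ?_⟩
          have hrx : |r • x| ≤ |r| • |x| := by
            rcases abs_cases r with ⟨hr, h0⟩ | ⟨hr, h0⟩
            · rw [hr]
              refine abs_le'.2 ⟨by gcongr; exact le_abs_self x, ?_⟩
              rw [← smul_neg]
              gcongr
              exact neg_le_abs x
            · have h0' : 0 ≤ -r := by linarith
              rw [hr]
              refine abs_le'.2 ⟨?_, ?_⟩
              · rw [← neg_smul_neg]
                exact smul_le_smul_of_nonneg_left (neg_le_abs x) h0'
              · rw [← neg_smul]
                exact smul_le_smul_of_nonneg_left (le_abs_self x) h0'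
          rw [mul_smul]
          exact hrx.trans (smul_le_smul_of_nonneg_left hc (abs_nonneg r)) }
    have hS : ∀ a ∈ S, ∀ b ∈ S, ∀ z, |z| ≤ |a| ⊔ |b| → z ∈ S := by
      rintro a ⟨c, hc⟩ b ⟨d, hd⟩ z hz
      refine ⟨c ⊔ d, hz.trans (sup_le (hc.trans ?_) (hd.trans ?_))⟩
      · exact smul_le_smul_of_nonneg_right le_sup_left hιu
      · exact smul_le_smul_of_nonneg_right le_sup_right hιu
    have hmem : ∀ x, x ∈ S := by
      refine hι_gen S (fun a ha b hb => hS a ha b hb _ ?_)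
        (fun a ha b hb => hS a ha b hb _ ?_) fun g => ?_
      · refine abs_le'.2 ⟨sup_le_sup (le_abs_self a) (le_abs_self b), ?_⟩
        rw [neg_sup]
        exact inf_le_left.trans ((neg_le_abs a).trans le_sup_left)
      · refine abs_le'.2 ⟨inf_le_left.trans ((le_abs_self a).trans le_sup_left), ?_⟩
        rw [neg_inf]
        exact sup_le_sup (neg_le_abs a) (neg_le_abs b)
      · obtain ⟨n, hn⟩ := hu |g|
        refine ⟨n, ?_⟩
        rw [Nat.cast_smul_eq_nsmul, ← hι.map_abs, ← hι.map_nsmul]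
        exact hι.monotone hn
    intro x
    obtain ⟨c, hc⟩ := hmem x
    obtain ⟨n, hn⟩ := exists_nat_ge c
    refine ⟨n, (le_abs_self x).trans (hc.trans ?_)⟩
    rw [← Nat.cast_smul_eq_nsmul ℝ]
    exact smul_le_smul_of_nonneg_right hn hιu
  let R : U → V → Prop := fun x y => ∀ φ : V → ℝ, IsLatticeGroupHom φ → φ v = 1 →
    ∀ ψ : U → ℝ, IsLatticeGroupHom ψ → (∀ g, ψ (ι g) = φ (f g)) → ψ x = φ y
  have R_unique : ∀ {x y z}, R x y → R x z → y = z := by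
    intro x y z hy hz
    rw [← sub_eq_zero]
    refine eq_zero_of_forall_isLatticeGroupHom_real hVarch hv0 hv _ fun φ hφ hφv => ?_
    obtain ⟨ψ, hψ, hψι⟩ := exists_extension_isLatticeGroupHom_real hι hι_inj hu0 hU
      (hφ.comp hf) (by simp [hfu, hφv])
    rw [hφ.map_sub, ← hy φ hφ hφv ψ hψ hψι, ← hz φ hφ hφv ψ hψ hψι, sub_self]
  have R_add : ∀ {a b c d}, R a c → R b d → R (a + b) (c + d) :=
    fun h h' φ hφ hφv ψ hψ hψι => by
      rw [hφ.map_add, hψ.map_add, h φ hφ hφv ψ hψ hψι, h' φ hφ hφv ψ hψ hψι]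
  have R_sup : ∀ {a b c d}, R a c → R b d → R (a ⊔ b) (c ⊔ d) :=
    fun h h' φ hφ hφv ψ hψ hψι => by
      rw [hφ.map_sup, hψ.map_sup, h φ hφ hφv ψ hψ hψι, h' φ hφ hφv ψ hψ hψι]
  have R_inf : ∀ {a b c d}, R a c → R b d → R (a ⊓ b) (c ⊓ d) :=
    fun h h' φ hφ hφv ψ hψ hψι => by
      rw [hφ.map_inf, hψ.map_inf, h φ hφ hφv ψ hψ hψι, h' φ hφ hφv ψ hψ hψι]
  have R_smul : ∀ (r : ℝ) {a c}, R a c → R (r • a) (r • c) :=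
    fun r a c h φ hφ hφv ψ hψ hψι => by
      rw [hφ.map_smul Real.nonpos_of_forall_nsmul_le, hψ.map_smul Real.nonpos_of_forall_nsmul_le,
        h φ hφ hφv ψ hψ hψι]
  have R_ι : ∀ g, R (ι g) (f g) := fun g φ _ _ ψ _ hψι => hψι g
  have R_exists : ∀ x, ∃ y, R x y := by
    let S : Submodule ℝ U :=
      { carrier := {x | ∃ y, R x y}
        zero_mem' := ⟨0, fun φ hφ _ ψ hψ _ => by rw [hφ.map_zero, hψ.map_zero]⟩
        add_mem' := fun ⟨_, h⟩ ⟨_, h'⟩ => ⟨_, R_add h h'⟩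
        smul_mem' := fun r _ ⟨_, h⟩ => ⟨_, R_smul r h⟩ }
    exact hι_gen S (fun _ ⟨_, h⟩ _ ⟨_, h'⟩ => ⟨_, R_sup h h'⟩)
      (fun _ ⟨_, h⟩ _ ⟨_, h'⟩ => ⟨_, R_inf h h'⟩) fun g => ⟨_, R_ι g⟩
  choose F hF using R_exists
  have hF_hom : IsLatticeGroupHom F :=
    ⟨fun a b => R_unique (hF _) (R_add (hF a) (hF b)),
      fun a b => R_unique (hF _) (R_sup (hF a) (hF b))⟩
  have hFι : ∀ g, F (ι g) = f g := fun g => R_unique (hF _) (R_ι g)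
  refine ⟨F, hF_hom.map_add, hF_hom.map_sup, hFι, hF_hom.map_smul hVarch, fun hf_inj => ?_,
    fun g' hg'_add hg'_sup hg'ι => ?_⟩
  · intro x y hxy
    by_contra hne
    have hpos : 0 < |x - y| := (abs_nonneg _).lt_of_ne fun h =>
      hne (sub_eq_zero.1 (eq_zero_of_lattice_abs_nonpos h.ge))
    obtain ⟨a, ha, n, hn⟩ := hι_ess _ hpos
    have h1 := hF_hom.monotone hn
    rw [hFι, hF_hom.map_nsmul, hF_hom.map_abs, hF_hom.map_sub, hxy, sub_self, abs_zero,
      nsmul_zero] at h1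
    have h2 : f a = f 0 := by
      rw [hf.map_zero]
      exact le_antisymm h1 (hf.map_nonneg ha.le)
    exact ha.ne' (hf_inj h2)
  · have hg' : IsLatticeGroupHom g' := ⟨hg'_add, hg'_sup⟩
    let S : Submodule ℝ U :=
      { carrier := {x | g' x = F x}
        zero_mem' := by simp [hg'.map_zero, hF_hom.map_zero]
        add_mem' := by
          intro a b ha hb
          simp_all [hg'.map_add, hF_hom.map_add]
        smul_mem' := by
          intro r a ha
          simp_all [hg'.map_smul hVarch, hF_hom.map_smul hVarch] }
    refine funext (hι_gen S (fun a ha b hb => ?_) (fun a ha b hb => ?_) fun g => ?_)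
    · change g' _ = F _
      rw [hg'.map_sup, hF_hom.map_sup, show g' a = F a from ha, show g' b = F b from hb]
    · change g' _ = F _
      rw [hg'.map_inf, hF_hom.map_inf, show g' a = F a from ha, show g' b = F b from hb]
    · exact (hg'ι g).trans (hFι g).symm
end

section
/- Let G be an archimedean lattice-ordered abelian group, and for i = 1, 2 let U_i be an archimedean Riesz space together with an injective lattice-group homomorphism ι_i : G → U_i such that U_i is the smallest vector sublattice of U_i containing ι_i(G). Then there exists an ℝ-linear lattice-group isomorphism φ : U_1 → U_2 with φ ∘ ι_1 = ι_2. (Uniqueness of the Riesz hull up to isomorphism.) -/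
section RieszHull

variable {G W : Type*} [AddCommGroup G] [AddCommGroup W] [Module ℝ W]

/-- `d` is a positive-integer fraction of an element of the range of `ι`. -/
def IsFractionOf (ι : G →+ W) (d : W) : Prop :=
  ∃ N : ℕ, 0 < N ∧ ∃ g : G, (N : ℝ) • d = ι g

namespace IsFractionOf

variable {ι : G →+ W} {d e : W}

lemma apply (ι : G →+ W) (g : G) : IsFractionOf ι (ι g) :=
  ⟨1, one_pos, g, by simp⟩

lemma add (hd : IsFractionOf ι d) (he : IsFractionOf ι e) : IsFractionOf ι (d + e) := by
  obtain ⟨N, hN, g, hg⟩ := hd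
  obtain ⟨M, hM, h, hh⟩ := he
  refine ⟨N * M, Nat.mul_pos hN hM, M • g + N • h, ?_⟩
  rw [map_add, map_nsmul, map_nsmul, ← hg, ← hh, ← Nat.cast_smul_eq_nsmul ℝ,
    ← Nat.cast_smul_eq_nsmul ℝ]
  push_cast
  module

lemma neg (hd : IsFractionOf ι d) : IsFractionOf ι (-d) := by
  obtain ⟨N, hN, g, hg⟩ := hd
  exact ⟨N, hN, -g, by rw [map_neg, ← hg, smul_neg]⟩

lemma div_smul (hd : IsFractionOf ι d) (p : ℕ) {M : ℕ} (hM : 0 < M) :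
    IsFractionOf ι (((p : ℝ) / M) • d) := by
  obtain ⟨N, hN, g, hg⟩ := hd
  have hM' : (M : ℝ) ≠ 0 := by positivity
  refine ⟨M * N, Nat.mul_pos hM hN, p • g, ?_⟩
  rw [map_nsmul, ← hg, ← Nat.cast_smul_eq_nsmul ℝ, smul_smul, smul_smul]
  congr 1
  push_cast
  field_simp

lemma sup [Lattice G] [Lattice W] [IsOrderedAddMonoid W] [PosSMulMono ℝ W]
    (hι : ∀ a b, ι (a ⊔ b) = ι a ⊔ ι b)
    (hd : IsFractionOf ι d) (he : IsFractionOf ι e) : IsFractionOf ι (d ⊔ e) := by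
  obtain ⟨N, hN, g, hg⟩ := hd
  obtain ⟨M, hM, h, hh⟩ := he
  refine ⟨N * M, Nat.mul_pos hN hM, M • g ⊔ N • h, ?_⟩
  have hpos : (0 : ℝ) < ((N * M : ℕ) : ℝ) := by exact_mod_cast Nat.mul_pos hN hM
  have hsup := (OrderIso.smulRight (β := W) hpos).map_sup d e
  simp only [OrderIso.smulRight_apply] at hsup
  rw [hι, map_nsmul, map_nsmul, ← hg, ← hh, ← Nat.cast_smul_eq_nsmul ℝ,
    ← Nat.cast_smul_eq_nsmul ℝ, hsup, smul_smul, smul_smul]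
  push_cast
  rw [mul_comm (M : ℝ)]

end IsFractionOf

variable [Lattice W]

/-- `x` is, up to arbitrarily small multiples of a fixed positive element `ι u` dominating `|x|`,
a fraction of an element of the range of `ι`. -/
def IsFractionLimit (ι : G →+ W) (x : W) : Prop :=
  ∃ u : G, 0 ≤ ι u ∧ x ≤ ι u ∧ -x ≤ ι u ∧ ∀ ε : ℝ, 0 < ε →
    ∃ d, IsFractionOf ι d ∧ x ≤ d + ε • ι u ∧ d ≤ x + ε • ι u

namespace IsFractionLimit

variable [IsOrderedAddMonoid W] {ι : G →+ W} {x y : W}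

lemma neg (hx : IsFractionLimit ι x) : IsFractionLimit ι (-x) := by
  obtain ⟨u, hu, hxu, hxu', H⟩ := hx
  refine ⟨u, hu, hxu', by simpa using hxu, fun ε hε => ?_⟩
  obtain ⟨d, hd, h₁, h₂⟩ := H ε hε
  refine ⟨-d, hd.neg, ?_, ?_⟩
  · exact sub_nonneg.1 ((sub_nonneg.2 h₂).trans_eq (by module))
  · exact sub_nonneg.1 ((sub_nonneg.2 h₁).trans_eq (by module))

lemma add (hx : IsFractionLimit ι x) (hy : IsFractionLimit ι y) :
    IsFractionLimit ι (x + y) := by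
  obtain ⟨u, hu, hxu, hxu', H⟩ := hx
  obtain ⟨v, hv, hyv, hyv', K⟩ := hy
  refine ⟨u + v, ?_, ?_, ?_, fun ε hε => ?_⟩
  · rw [map_add]; exact add_nonneg hu hv
  · rw [map_add]; exact add_le_add hxu hyv
  · rw [map_add, neg_add]; exact add_le_add hxu' hyv'
  · obtain ⟨d, hd, h₁, h₂⟩ := H ε hε
    obtain ⟨e, he, k₁, k₂⟩ := K ε hε
    refine ⟨d + e, hd.add he, ?_, ?_⟩ <;> rw [map_add]
    · exact sub_nonneg.1 ((sub_nonneg.2 (add_le_add h₁ k₁)).trans_eq (by module))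
    · exact sub_nonneg.1 ((sub_nonneg.2 (add_le_add h₂ k₂)).trans_eq (by module))

variable [PosSMulMono ℝ W]

lemma sup [Lattice G] (hι : ∀ a b, ι (a ⊔ b) = ι a ⊔ ι b)
    (hx : IsFractionLimit ι x) (hy : IsFractionLimit ι y) : IsFractionLimit ι (x ⊔ y) := by
  obtain ⟨u, hu, hxu, hxu', H⟩ := hx
  obtain ⟨v, hv, hyv, hyv', K⟩ := hy
  refine ⟨u + v, ?_, ?_, ?_, fun ε hε => ?_⟩
  · rw [map_add]; exact add_nonneg hu hv
  · rw [map_add]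
    exact sup_le (hxu.trans (le_add_of_nonneg_right hv)) (hyv.trans (le_add_of_nonneg_left hu))
  · rw [map_add, neg_sup]
    exact inf_le_left.trans (hxu'.trans (le_add_of_nonneg_right hv))
  · obtain ⟨d, hd, h₁, h₂⟩ := H ε hε
    obtain ⟨e, he, k₁, k₂⟩ := K ε hε
    have hu' : ε • ι u ≤ ε • ι (u + v) := by
      rw [map_add]
      exact smul_le_smul_of_nonneg_left (le_add_of_nonneg_right hv) hε.le
    have hv' : ε • ι v ≤ ε • ι (u + v) := by
      rw [map_add]
      exact smul_le_smul_of_nonneg_left (le_add_of_nonneg_left hu) hε.le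
    exact ⟨d ⊔ e, hd.sup hι he,
      sup_le (h₁.trans (add_le_add le_sup_left hu')) (k₁.trans (add_le_add le_sup_right hv')),
      sup_le (h₂.trans (add_le_add le_sup_left hu')) (k₂.trans (add_le_add le_sup_right hv'))⟩

lemma apply [Lattice G] (hι : ∀ a b, ι (a ⊔ b) = ι a ⊔ ι b) (g : G) :
    IsFractionLimit ι (ι g) := by
  have hu : 0 ≤ ι (g ⊔ 0 + -g ⊔ 0) := by
    rw [map_add, hι, hι, map_zero]
    exact add_nonneg le_sup_right le_sup_right
  refine ⟨g ⊔ 0 + -g ⊔ 0, hu, ?_, ?_, fun ε hε => ⟨ι g, .apply ι g, ?_, ?_⟩⟩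
  · rw [map_add, hι, hι, map_zero]
    exact le_sup_left.trans (le_add_of_nonneg_right le_sup_right)
  · rw [map_add, hι, hι, map_zero, map_neg]
    exact le_sup_left.trans (le_add_of_nonneg_left le_sup_right)
  all_goals exact le_add_of_nonneg_right (smul_nonneg hε.le hu)

lemma smul_of_nonneg (hx : IsFractionLimit ι x) {r : ℝ} (hr : 0 ≤ r) :
    IsFractionLimit ι (r • x) := by
  obtain ⟨u, hu, hxu, hxu', H⟩ := hx
  have hbound : r • ι u ≤ ((⌈r⌉₊ + 1 : ℕ) : ℝ) • ι u :=
    smul_le_smul_of_nonneg_right ((Nat.le_ceil r).trans (by simp)) hu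
  have hmul : ι ((⌈r⌉₊ + 1) • u) = ((⌈r⌉₊ + 1 : ℕ) : ℝ) • ι u := by
    rw [map_nsmul, Nat.cast_smul_eq_nsmul]
  refine ⟨(⌈r⌉₊ + 1) • u, ?_, ?_, ?_, fun ε hε => ?_⟩
  · rw [hmul]; exact smul_nonneg (Nat.cast_nonneg _) hu
  · rw [hmul]; exact (smul_le_smul_of_nonneg_left hxu hr).trans hbound
  · rw [hmul, ← smul_neg]; exact (smul_le_smul_of_nonneg_left hxu' hr).trans hbound
  · obtain ⟨d, hd, h₁, h₂⟩ := H ε hε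
    obtain ⟨M, hM⟩ := exists_nat_gt ε⁻¹
    have hM0 : (0 : ℝ) < M := (inv_pos.2 hε).trans hM
    set q : ℝ := (⌊r * M⌋₊ : ℝ) / M with hq
    have hq0 : 0 ≤ q := by positivity
    have hqr : q ≤ r := by
      rw [hq, div_le_iff₀ hM0]
      exact Nat.floor_le (by positivity)
    have hrq : r - q ≤ ε := by
      have h1 := Nat.lt_floor_add_one (r * M)
      have h2 : 1 < M * ε := by rwa [inv_lt_iff_one_lt_mul₀ hε] at hM
      have h3 : q * M = ⌊r * M⌋₊ := by rw [hq]; field_simp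
      nlinarith
    have hle : (ε + q * ε) • ι u ≤ ε • ι ((⌈r⌉₊ + 1) • u) := by
      rw [hmul, smul_smul]
      refine smul_le_smul_of_nonneg_right ?_ hu
      push_cast
      nlinarith [Nat.le_ceil r]
    have hdiff : (r - q) • ι u ≤ ε • ι u := smul_le_smul_of_nonneg_right hrq hu
    have e₁ := (smul_le_smul_of_nonneg_left hxu (sub_nonneg.2 hqr)).trans hdiff
    have e₂ := (smul_le_smul_of_nonneg_left hxu' (sub_nonneg.2 hqr)).trans hdiff
    have f₁ := smul_le_smul_of_nonneg_left h₁ hq0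
    have f₂ := smul_le_smul_of_nonneg_left h₂ hq0
    refine ⟨q • d, hd.div_smul _ (by exact_mod_cast hM0), ?_, ?_⟩
    · exact sub_nonneg.1
        ((sub_nonneg.2 (add_le_add (add_le_add e₁ f₁) hle)).trans_eq (by module))
    · exact sub_nonneg.1
        ((sub_nonneg.2 (add_le_add (add_le_add e₂ f₂) hle)).trans_eq (by module))

lemma smul (hx : IsFractionLimit ι x) (r : ℝ) : IsFractionLimit ι (r • x) := by
  rcases le_total 0 r with hr | hr
  · exact hx.smul_of_nonneg hr
  · simpa using (hx.smul_of_nonneg (neg_nonneg.2 hr)).neg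

lemma inf [Lattice G] (hι : ∀ a b, ι (a ⊔ b) = ι a ⊔ ι b)
    (hx : IsFractionLimit ι x) (hy : IsFractionLimit ι y) : IsFractionLimit ι (x ⊓ y) := by
  simpa [neg_sup] using (hx.neg.sup hι hy.neg).neg

end IsFractionLimit

/-- The subspace of fraction limits of a lattice-group homomorphism. -/
def fractionLimitSubmodule [Lattice G] [IsOrderedAddMonoid W] [PosSMulMono ℝ W] (ι : G →+ W)
    (hι : ∀ a b, ι (a ⊔ b) = ι a ⊔ ι b) : Submodule ℝ W where
  carrier := {x | IsFractionLimit ι x}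
  zero_mem' := by simpa using IsFractionLimit.apply hι 0
  add_mem' := IsFractionLimit.add
  smul_mem' r _ hx := hx.smul r

variable {U V : Type*} [Lattice U] [AddCommGroup U] [IsOrderedAddMonoid U]
  [Module ℝ U] [PosSMulMono ℝ U]
  [Lattice V] [AddCommGroup V] [IsOrderedAddMonoid V] [Module ℝ V] [PosSMulMono ℝ V]

lemma map_le_map_iff_of_injective_of_map_sup {L M : Type*} [Lattice L] [Lattice M] {f : L → M}
    (hf : Function.Injective f) (hsup : ∀ a b, f (a ⊔ b) = f a ⊔ f b) {a b : L} :
    f a ≤ f b ↔ a ≤ b := by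
  rw [← sup_eq_right, ← hsup, hf.eq_iff, sup_eq_right]

lemma IsFractionLimit.nonpos_of_map_nonpos
    {ι : G →+ W} {w : W} (hw : IsFractionLimit ι w)
    (f : W →ₗ[ℝ] U) (k : W →ₗ[ℝ] V) (hf : Monotone f) (hk : Monotone k)
    (harch : ∀ x y : V, (∀ n : ℕ, n • x ≤ y) → x ≤ 0)
    (hle : ∀ a b : G, f (ι a) ≤ f (ι b) → k (ι a) ≤ k (ι b))
    (hw0 : f w ≤ 0) : k w ≤ 0 := by
  obtain ⟨u, hu, -, -, H⟩ := hw
  have hku : 0 ≤ k (ι u) := by simpa using hk hu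
  refine harch _ ((2 : ℝ) • k (ι u)) fun n => ?_
  rcases n.eq_zero_or_pos with rfl | hn
  · simpa using smul_nonneg zero_le_two hku
  have hn' : (0 : ℝ) < n := by exact_mod_cast hn
  obtain ⟨d, ⟨N, hN, g, hg⟩, h₁, h₂⟩ := H (n : ℝ)⁻¹ (by positivity)
  have hN' : (0 : ℝ) < N := by exact_mod_cast hN
  have hfd : f d ≤ (n : ℝ)⁻¹ • f (ι u) := by
    have := hf h₂
    rw [map_add, map_smul] at this
    exact this.trans (add_le_of_nonpos_left hw0)
  have hfg : f (ι (n • g)) ≤ f (ι (N • u)) := by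
    have := smul_le_smul_of_nonneg_left hfd (mul_pos hn' hN').le
    rw [map_nsmul ι, map_nsmul ι, ← hg, ← Nat.cast_smul_eq_nsmul ℝ, ← Nat.cast_smul_eq_nsmul ℝ,
      map_smul f, map_smul f, map_smul f, smul_smul]
    refine this.trans_eq ?_
    rw [smul_smul]
    congr 1
    field_simp
  have hkd : (n : ℝ) • k d ≤ k (ι u) := by
    have := hle _ _ hfg
    rw [map_nsmul ι, map_nsmul ι, ← hg, ← Nat.cast_smul_eq_nsmul ℝ, ← Nat.cast_smul_eq_nsmul ℝ,
      map_smul k, map_smul k, map_smul k, smul_comm] at this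
    exact le_of_smul_le_smul_of_pos_left this hN'
  have hkw : (n : ℝ) • k w ≤ (n : ℝ) • k d + k (ι u) := by
    have := smul_le_smul_of_nonneg_left (hk h₁) hn'.le
    rwa [map_add, map_smul, smul_add, smul_smul, mul_inv_cancel₀ hn'.ne', one_smul] at this
  rw [← Nat.cast_smul_eq_nsmul ℝ, two_smul]
  exact hkw.trans (add_le_add_left hkd _)

end RieszHull


/-- Uniqueness of the Riesz hull up to isomorphism: two Riesz hulls of the same
archimedean lattice-ordered abelian group `G` are related by an `ℝ`-linear
lattice-group isomorphism compatible with the embeddings. -/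
theorem riesz_hull_unique
    (G : Type) [Lattice G] [AddCommGroup G]
    (hGcov : ∀ a b c : G, a ≤ b → a + c ≤ b + c)
    (hGarch : ∀ x y : G, (∀ n : ℕ, n • x ≤ y) → x ≤ 0)
    (U₁ : Type) [Lattice U₁] [AddCommGroup U₁] [Module ℝ U₁]
    (hU₁cov : ∀ a b c : U₁, a ≤ b → a + c ≤ b + c)
    (hU₁pos : ∀ (r : ℝ) (x : U₁), 0 ≤ r → 0 ≤ x → 0 ≤ r • x)
    (hU₁arch : ∀ x y : U₁, (∀ n : ℕ, n • x ≤ y) → x ≤ 0)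
    (ι₁ : G → U₁) (hι₁_inj : Function.Injective ι₁)
    (hι₁_add : ∀ a b : G, ι₁ (a + b) = ι₁ a + ι₁ b)
    (hι₁_sup : ∀ a b : G, ι₁ (a ⊔ b) = ι₁ a ⊔ ι₁ b)
    (hι₁_gen : ∀ S : Submodule ℝ U₁, (∀ a ∈ S, ∀ b ∈ S, a ⊔ b ∈ S) →
      (∀ a ∈ S, ∀ b ∈ S, a ⊓ b ∈ S) → (∀ g : G, ι₁ g ∈ S) → ∀ x : U₁, x ∈ S)
    (U₂ : Type) [Lattice U₂] [AddCommGroup U₂] [Module ℝ U₂]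
    (hU₂cov : ∀ a b c : U₂, a ≤ b → a + c ≤ b + c)
    (hU₂pos : ∀ (r : ℝ) (x : U₂), 0 ≤ r → 0 ≤ x → 0 ≤ r • x)
    (hU₂arch : ∀ x y : U₂, (∀ n : ℕ, n • x ≤ y) → x ≤ 0)
    (ι₂ : G → U₂) (hι₂_inj : Function.Injective ι₂)
    (hι₂_add : ∀ a b : G, ι₂ (a + b) = ι₂ a + ι₂ b)
    (hι₂_sup : ∀ a b : G, ι₂ (a ⊔ b) = ι₂ a ⊔ ι₂ b)
    (hι₂_gen : ∀ S : Submodule ℝ U₂, (∀ a ∈ S, ∀ b ∈ S, a ⊔ b ∈ S) →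
      (∀ a ∈ S, ∀ b ∈ S, a ⊓ b ∈ S) → (∀ g : G, ι₂ g ∈ S) → ∀ x : U₂, x ∈ S) :
    ∃ φ : U₁ → U₂,
      Function.Bijective φ ∧
      (∀ a b : U₁, φ (a + b) = φ a + φ b) ∧
      (∀ (r : ℝ) (x : U₁), φ (r • x) = r • φ x) ∧
      (∀ a b : U₁, φ (a ⊔ b) = φ a ⊔ φ b) ∧
      (∀ g : G, φ (ι₁ g) = ι₂ g) := by
  have : IsOrderedAddMonoid U₁ :=
    { add_le_add_left := fun a b h c => hU₁cov a b c h }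
  have : IsOrderedAddMonoid U₂ :=
    { add_le_add_left := fun a b h c => hU₂cov a b c h }
  have : PosSMulMono ℝ U₁ := .of_smul_nonneg fun r hr x hx => hU₁pos r x hr hx
  have : PosSMulMono ℝ U₂ := .of_smul_nonneg fun r hr x hx => hU₂pos r x hr hx
  let ι : G →+ U₁ × U₂ := (AddMonoidHom.mk' ι₁ hι₁_add).prod (AddMonoidHom.mk' ι₂ hι₂_add)
  have hι : ∀ a b, ι (a ⊔ b) = ι a ⊔ ι b := fun a b => Prod.ext (hι₁_sup a b) (hι₂_sup a b)
  let H := fractionLimitSubmodule ι hι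
  let p : H →ₗ[ℝ] U₁ := LinearMap.fst ℝ U₁ U₂ ∘ₗ H.subtype
  let q : H →ₗ[ℝ] U₂ := LinearMap.snd ℝ U₁ U₂ ∘ₗ H.subtype
  have hle₁₂ (a b : G) (h : ι₁ a ≤ ι₁ b) : ι₂ a ≤ ι₂ b :=
    (map_le_map_iff_of_injective_of_map_sup hι₂_inj hι₂_sup).2
      ((map_le_map_iff_of_injective_of_map_sup hι₁_inj hι₁_sup).1 h)
  have hle₂₁ (a b : G) (h : ι₂ a ≤ ι₂ b) : ι₁ a ≤ ι₁ b :=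
    (map_le_map_iff_of_injective_of_map_sup hι₁_inj hι₁_sup).2
      ((map_le_map_iff_of_injective_of_map_sup hι₂_inj hι₂_sup).1 h)
  have hpq (w : H) (hw : p w ≤ 0) : q w ≤ 0 :=
    w.2.nonpos_of_map_nonpos (LinearMap.fst ℝ U₁ U₂) (LinearMap.snd ℝ U₁ U₂)
      monotone_fst monotone_snd hU₂arch hle₁₂ hw
  have hqp (w : H) (hw : q w ≤ 0) : p w ≤ 0 :=
    w.2.nonpos_of_map_nonpos (LinearMap.snd ℝ U₁ U₂) (LinearMap.fst ℝ U₁ U₂)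
      monotone_snd monotone_fst hU₁arch hle₂₁ hw
  have hker (w : H) : p w = 0 ↔ q w = 0 := by
    constructor <;> intro h
    · refine le_antisymm (hpq w h.le) (neg_nonpos.1 ?_)
      simpa using hpq (-w) (by simp [h])
    · refine le_antisymm (hqp w h.le) (neg_nonpos.1 ?_)
      simpa using hqp (-w) (by simp [h])
  have hp_inj : Function.Injective p := (injective_iff_map_eq_zero p).2 fun w hw =>
    Subtype.ext (Prod.ext hw ((hker w).1 hw))
  have hq_inj : Function.Injective q := (injective_iff_map_eq_zero q).2 fun w hw =>
    Subtype.ext (Prod.ext ((hker w).2 hw) hw)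
  have hp_surj : Function.Surjective p := hι₁_gen (LinearMap.range p)
    (by rintro _ ⟨a, rfl⟩ _ ⟨b, rfl⟩; exact ⟨⟨_, a.2.sup hι b.2⟩, rfl⟩)
    (by rintro _ ⟨a, rfl⟩ _ ⟨b, rfl⟩; exact ⟨⟨_, a.2.inf hι b.2⟩, rfl⟩)
    fun g => ⟨⟨_, .apply hι g⟩, rfl⟩
  have hq_surj : Function.Surjective q := hι₂_gen (LinearMap.range q)
    (by rintro _ ⟨a, rfl⟩ _ ⟨b, rfl⟩; exact ⟨⟨_, a.2.sup hι b.2⟩, rfl⟩)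
    (by rintro _ ⟨a, rfl⟩ _ ⟨b, rfl⟩; exact ⟨⟨_, a.2.inf hι b.2⟩, rfl⟩)
    fun g => ⟨⟨_, .apply hι g⟩, rfl⟩
  let P := LinearEquiv.ofBijective p ⟨hp_inj, hp_surj⟩
  let Q := LinearEquiv.ofBijective q ⟨hq_inj, hq_surj⟩
  have hφ (w : H) : (P.symm.trans Q) (p w) = q w :=
    congrArg Q (P.symm_apply_apply w)
  refine ⟨P.symm.trans Q, LinearEquiv.bijective _, map_add _, map_smul _, fun a b => ?_,
    fun g => hφ ⟨_, .apply hι g⟩⟩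
  obtain ⟨a, rfl⟩ := hp_surj a
  obtain ⟨b, rfl⟩ := hp_surj b
  rw [hφ a, hφ b]
  exact hφ ⟨_, a.2.sup hι b.2⟩
end

section
/- Let V be an archimedean Riesz space and let G be a subgroup of the additive group of V closed under binary suprema and infima, such that V is the smallest vector sublattice of V containing G. Then the inclusion of G into V is essential: for every v ∈ V with v > 0 there exist g ∈ G with g > 0 and n ∈ ℕ with g ≤ n • v. -/
section RieszSpace

variable {V : Type*} [AddCommGroup V]

/-- The elements of `V` having a positive natural multiple in `G`. -/
def divisibleHull (G : AddSubgroup V) : Set V := {x | ∃ N : ℕ, 0 < N ∧ N • x ∈ G}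

variable {G : AddSubgroup V}

theorem subset_divisibleHull {g : V} (hg : g ∈ G) : g ∈ divisibleHull G :=
  ⟨1, one_pos, by simpa using hg⟩

/-- Two elements of the divisible hull have a common denominator. -/
theorem exists_common_denominator {x y : V} (hx : x ∈ divisibleHull G)
    (hy : y ∈ divisibleHull G) : ∃ N : ℕ, 0 < N ∧ N • x ∈ G ∧ N • y ∈ G := by
  obtain ⟨N, hN, hNx⟩ := hx
  obtain ⟨M, hM, hMy⟩ := hy
  refine ⟨N * M, Nat.mul_pos hN hM, ?_, ?_⟩
  · rw [mul_comm, mul_smul]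
    exact G.nsmul_mem hNx M
  · rw [mul_smul]
    exact G.nsmul_mem hMy N

theorem divisibleHull_add {x y : V} (hx : x ∈ divisibleHull G)
    (hy : y ∈ divisibleHull G) : x + y ∈ divisibleHull G := by
  obtain ⟨N, hN, h₁, h₂⟩ := exists_common_denominator hx hy
  exact ⟨N, hN, by rw [smul_add]; exact G.add_mem h₁ h₂⟩

theorem divisibleHull_neg {x : V} (hx : x ∈ divisibleHull G) : -x ∈ divisibleHull G := by
  obtain ⟨N, hN, h⟩ := hx
  exact ⟨N, hN, by rw [smul_neg]; exact G.neg_mem h⟩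

variable [Module ℝ V]

theorem divisibleHull_rat_smul (q : ℚ) {x : V} (hx : x ∈ divisibleHull G) :
    (q : ℝ) • x ∈ divisibleHull G := by
  obtain ⟨N, hN, h⟩ := hx
  refine ⟨N * q.den, Nat.mul_pos hN q.den_pos, ?_⟩
  have hq : (q.den : ℝ) * (q : ℝ) = q.num := by
    exact_mod_cast Rat.den_mul_eq_num q
  have : (N * q.den) • ((q : ℝ) • x) = q.num • (N • x) := by
    rw [← Nat.cast_smul_eq_nsmul ℝ, ← Nat.cast_smul_eq_nsmul ℝ, ← Int.cast_smul_eq_zsmul ℝ,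
      smul_smul, smul_smul, Nat.cast_mul, mul_assoc, hq, mul_comm]
  rw [this]
  exact G.zsmul_mem h _

section PosSMulMono

variable [Lattice V] [PosSMulMono ℝ V]

/-- Positive natural multiples distribute over binary suprema. -/
theorem nsmul_sup_of_pos {N : ℕ} (hN : 0 < N) (x y : V) :
    N • (x ⊔ y) = N • x ⊔ N • y := by
  have h : (0 : ℝ) < N := by exact_mod_cast hN
  simpa only [OrderIso.smulRight_apply, Nat.cast_smul_eq_nsmul] using
    (OrderIso.smulRight (β := V) h).map_sup x y

/-- Positive natural multiples distribute over binary infima. -/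
theorem nsmul_inf_of_pos {N : ℕ} (hN : 0 < N) (x y : V) :
    N • (x ⊓ y) = N • x ⊓ N • y := by
  have h : (0 : ℝ) < N := by exact_mod_cast hN
  simpa only [OrderIso.smulRight_apply, Nat.cast_smul_eq_nsmul] using
    (OrderIso.smulRight (β := V) h).map_inf x y

theorem divisibleHull_sup (hGsup : ∀ a ∈ G, ∀ b ∈ G, a ⊔ b ∈ G) {x y : V}
    (hx : x ∈ divisibleHull G) (hy : y ∈ divisibleHull G) : x ⊔ y ∈ divisibleHull G := by
  obtain ⟨N, hN, h₁, h₂⟩ := exists_common_denominator hx hy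
  exact ⟨N, hN, by rw [nsmul_sup_of_pos hN]; exact hGsup _ h₁ _ h₂⟩

theorem divisibleHull_inf (hGinf : ∀ a ∈ G, ∀ b ∈ G, a ⊓ b ∈ G) {x y : V}
    (hx : x ∈ divisibleHull G) (hy : y ∈ divisibleHull G) : x ⊓ y ∈ divisibleHull G := by
  obtain ⟨N, hN, h₁, h₂⟩ := exists_common_denominator hx hy
  exact ⟨N, hN, by rw [nsmul_inf_of_pos hN]; exact hGinf _ h₁ _ h₂⟩

end PosSMulMono

variable [Lattice V]

/-- `x` is approximable by the divisible hull of `G`, uniformly relative to `e`. -/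
def ApproxBy (G : AddSubgroup V) (e x : V) : Prop :=
  ∀ ε : ℝ, 0 < ε → ∃ y ∈ divisibleHull G, x ≤ y + ε • e ∧ y ≤ x + ε • e

theorem ApproxBy.of_mem {g : V} (hg : g ∈ G) : ApproxBy G 0 g :=
  fun ε _ ↦ ⟨g, subset_divisibleHull hg, by simp, by simp⟩

variable [IsOrderedAddMonoid V]

theorem ApproxBy.neg {e x : V} (h : ApproxBy G e x) : ApproxBy G e (-x) := by
  intro ε hε
  obtain ⟨y, hy, h₁, h₂⟩ := h ε hε
  refine ⟨-y, divisibleHull_neg hy, ?_, ?_⟩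
  · rw [neg_le_iff_add_nonneg, show -y + ε • e + x = x + ε • e - y by abel]
    exact sub_nonneg.2 h₂
  · rw [neg_le_iff_add_nonneg, show -x + ε • e + y = y + ε • e - x by abel]
    exact sub_nonneg.2 h₁

theorem ApproxBy.add {e f x x' : V} (h : ApproxBy G e x) (h' : ApproxBy G f x') :
    ApproxBy G (e + f) (x + x') := by
  intro ε hε
  obtain ⟨y, hy, h₁, h₂⟩ := h ε hε
  obtain ⟨y', hy', h₁', h₂'⟩ := h' ε hε
  refine ⟨y + y', divisibleHull_add hy hy', ?_, ?_⟩
  · rw [smul_add, add_add_add_comm]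
    exact add_le_add h₁ h₁'
  · rw [smul_add, add_add_add_comm]
    exact add_le_add h₂ h₂'

variable [PosSMulMono ℝ V]

theorem ApproxBy.mono {e f x : V} (h : ApproxBy G e x) (hef : e ≤ f) : ApproxBy G f x := by
  intro ε hε
  obtain ⟨y, hy, h₁, h₂⟩ := h ε hε
  have h₃ : ε • e ≤ ε • f := smul_le_smul_of_nonneg_left hef hε.le
  exact ⟨y, hy, h₁.trans (by gcongr), h₂.trans (by gcongr)⟩

theorem ApproxBy.sup (hGsup : ∀ a ∈ G, ∀ b ∈ G, a ⊔ b ∈ G) {e x x' : V}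
    (h : ApproxBy G e x) (h' : ApproxBy G e x') : ApproxBy G e (x ⊔ x') := by
  intro ε hε
  obtain ⟨y, hy, h₁, h₂⟩ := h ε hε
  obtain ⟨y', hy', h₁', h₂'⟩ := h' ε hε
  refine ⟨y ⊔ y', divisibleHull_sup hGsup hy hy', ?_, ?_⟩
  · rw [sup_add]
    exact sup_le_sup h₁ h₁'
  · rw [sup_add]
    exact sup_le_sup h₂ h₂'

theorem ApproxBy.inf (hGinf : ∀ a ∈ G, ∀ b ∈ G, a ⊓ b ∈ G) {e x x' : V}
    (h : ApproxBy G e x) (h' : ApproxBy G e x') : ApproxBy G e (x ⊓ x') := by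
  intro ε hε
  obtain ⟨y, hy, h₁, h₂⟩ := h ε hε
  obtain ⟨y', hy', h₁', h₂'⟩ := h' ε hε
  refine ⟨y ⊓ y', divisibleHull_inf hGinf hy hy', ?_, ?_⟩
  · rw [inf_add]
    exact inf_le_inf h₁ h₁'
  · rw [inf_add]
    exact inf_le_inf h₂ h₂'

/-- An approximable element is bounded above by a nonnegative element of `G`. -/
theorem ApproxBy.exists_le (hGsup : ∀ a ∈ G, ∀ b ∈ G, a ⊔ b ∈ G) {e x : V} (he : e ∈ G)
    (h : ApproxBy G e x) : ∃ b ∈ G, 0 ≤ b ∧ x ≤ b := by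
  obtain ⟨y, hy, h₁, -⟩ := h 1 one_pos
  rw [one_smul] at h₁
  obtain ⟨N, hN, hz⟩ := divisibleHull_add hy (subset_divisibleHull he)
  refine ⟨N • (y + e) ⊔ 0, hGsup _ hz _ G.zero_mem, le_sup_right, h₁.trans ?_⟩
  calc y + e ≤ (y + e) ⊔ 0 := le_sup_left
    _ ≤ N • ((y + e) ⊔ 0) := le_self_nsmul le_sup_right hN.ne'
    _ = N • (y + e) ⊔ 0 := by rw [nsmul_sup_of_pos hN, smul_zero]

theorem ApproxBy.smul_of_nonneg {e b x : V} (he : 0 ≤ e) (hb : 0 ≤ b) (hxb : x ≤ b)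
    (hbx : -x ≤ b) (h : ApproxBy G e x) {r : ℝ} (hr : 0 ≤ r) :
    ApproxBy G (b + e) (r • x) := by
  intro ε hε
  obtain ⟨q, hrq, hq⟩ := exists_rat_btwn (show r < r + min ε 1 by simp [hε])
  have hqε : (q : ℝ) - r ≤ ε := by linarith [min_le_left ε 1]
  have hq1 : (q : ℝ) ≤ r + 1 := by linarith [min_le_right ε 1]
  have hq0 : (0 : ℝ) ≤ q := hr.trans hrq.le
  have hr1 : 0 < r + 1 := by linarith
  obtain ⟨y, hy, h₁, h₂⟩ := h (ε / (r + 1)) (by positivity)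
  have hbound : (q : ℝ) • (ε / (r + 1)) • e ≤ ε • e := by
    rw [smul_smul]
    refine smul_le_smul_of_nonneg_right ?_ he
    rw [mul_div_assoc', div_le_iff₀ hr1]
    nlinarith
  have hscale : ∀ z : V, z ≤ b → ((q : ℝ) - r) • z ≤ ε • b := fun z hz ↦
    (smul_le_smul_of_nonneg_left hz (by linarith)).trans (smul_le_smul_of_nonneg_right hqε hb)
  refine ⟨(q : ℝ) • y, divisibleHull_rat_smul q hy, ?_, ?_⟩
  · calc r • x = (q : ℝ) • x + ((q : ℝ) - r) • (-x) := by module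
      _ ≤ (q : ℝ) • (y + (ε / (r + 1)) • e) + ε • b :=
        add_le_add (smul_le_smul_of_nonneg_left h₁ hq0) (hscale _ hbx)
      _ = (q : ℝ) • y + (ε • b + (q : ℝ) • (ε / (r + 1)) • e) := by rw [smul_add]; abel
      _ ≤ (q : ℝ) • y + ε • (b + e) := by rw [smul_add ε]; gcongr
  · calc (q : ℝ) • y ≤ (q : ℝ) • (x + (ε / (r + 1)) • e) :=
        smul_le_smul_of_nonneg_left h₂ hq0
      _ = r • x + (((q : ℝ) - r) • x + (q : ℝ) • (ε / (r + 1)) • e) := by module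
      _ ≤ r • x + ε • (b + e) := by
        rw [smul_add ε]
        exact add_le_add le_rfl (add_le_add (hscale _ hxb) hbound)

/-- The vector sublattice of elements that are relatively uniform limits of elements of the
divisible hull of a sublattice-subgroup. -/
def approximableSubmodule (G : AddSubgroup V) (hGsup : ∀ a ∈ G, ∀ b ∈ G, a ⊔ b ∈ G) :
    Submodule ℝ V where
  carrier := {x | ∃ e ∈ G, 0 ≤ e ∧ ApproxBy G e x}
  zero_mem' := ⟨0, G.zero_mem, le_rfl, .of_mem G.zero_mem⟩
  add_mem' := by
    rintro x y ⟨e, he, he0, hx⟩ ⟨f, hf, hf0, hy⟩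
    exact ⟨e + f, G.add_mem he hf, add_nonneg he0 hf0, hx.add hy⟩
  smul_mem' := by
    rintro r x ⟨e, he, he0, hx⟩
    obtain ⟨b, hb, hb0, hxb⟩ := hx.exists_le hGsup he
    obtain ⟨c, hc, hc0, hxc⟩ := hx.neg.exists_le hGsup he
    have hxb' : x ≤ b + c := hxb.trans (le_add_of_nonneg_right hc0)
    have hxc' : -x ≤ b + c := hxc.trans (le_add_of_nonneg_left hb0)
    have hbc0 := add_nonneg hb0 hc0
    refine ⟨b + c + e, G.add_mem (G.add_mem hb hc) he, add_nonneg hbc0 he0, ?_⟩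
    rcases le_total 0 r with hr | hr
    · exact hx.smul_of_nonneg he0 hbc0 hxb' hxc' hr
    · have := (hx.smul_of_nonneg he0 hbc0 hxb' hxc' (neg_nonneg.2 hr)).neg
      rwa [neg_smul, neg_neg] at this

/-- A strictly positive approximable element of an archimedean space dominates a strictly
positive element of the divisible hull. -/
theorem ApproxBy.exists_pos_le (hVarch : ∀ x y : V, (∀ n : ℕ, n • x ≤ y) → x ≤ 0)
    (hGsup : ∀ a ∈ G, ∀ b ∈ G, a ⊔ b ∈ G) {e v : V} (he : e ∈ G) (he0 : 0 ≤ e)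
    (h : ApproxBy G e v) (hv : 0 < v) : ∃ z ∈ divisibleHull G, 0 < z ∧ z ≤ v := by
  by_contra! hcon
  refine hv.not_ge (hVarch v ((2 : ℝ) • e) fun k ↦ ?_)
  rcases Nat.eq_zero_or_pos k with rfl | hk
  · simpa using smul_nonneg zero_le_two he0
  have hk' : (0 : ℝ) < k := by exact_mod_cast hk
  obtain ⟨y, hy, h₁, h₂⟩ := h ((k : ℝ)⁻¹) (by positivity)
  have hke : (k : ℝ)⁻¹ • e ∈ divisibleHull G := by
    simpa using divisibleHull_rat_smul ((k : ℚ)⁻¹) (subset_divisibleHull he)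
  have hz : (y + -((k : ℝ)⁻¹ • e)) ⊔ 0 ∈ divisibleHull G :=
    divisibleHull_sup hGsup (divisibleHull_add hy (divisibleHull_neg hke))
      (subset_divisibleHull G.zero_mem)
  have hzv : (y + -((k : ℝ)⁻¹ • e)) ⊔ 0 ≤ v :=
    sup_le (by rw [← sub_eq_add_neg]; exact sub_le_iff_le_add.2 h₂) hv.le
  have hz0 : ¬ 0 < (y + -((k : ℝ)⁻¹ • e)) ⊔ 0 := fun hpos ↦ hcon _ hz hpos hzv
  have hz_eq : (y + -((k : ℝ)⁻¹ • e)) ⊔ 0 = 0 :=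
    (eq_of_le_of_not_lt le_sup_right hz0).symm
  have hye : y ≤ (k : ℝ)⁻¹ • e := by
    rw [sup_eq_right, ← sub_eq_add_neg] at hz_eq
    exact sub_nonpos.1 hz_eq
  calc k • v = (k : ℝ) • v := (Nat.cast_smul_eq_nsmul ℝ k v).symm
    _ ≤ (k : ℝ) • ((k : ℝ)⁻¹ • e + (k : ℝ)⁻¹ • e) :=
      smul_le_smul_of_nonneg_left (h₁.trans (by gcongr)) hk'.le
    _ = (2 : ℝ) • e := by
      rw [← two_smul ℝ ((k : ℝ)⁻¹ • e), smul_comm, smul_inv_smul₀ hk'.ne']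

end RieszSpace


/-- If `V` is an archimedean Riesz space and `G` is a sublattice-subgroup of `V`
such that `V` is the smallest vector sublattice of `V` containing `G`, then the
inclusion of `G` into `V` is essential. -/
theorem sublattice_subgroup_generating_is_essential
    (V : Type) [Lattice V] [AddCommGroup V] [Module ℝ V]
    (hVcov : ∀ a b c : V, a ≤ b → a + c ≤ b + c)
    (hVpos : ∀ (r : ℝ) (x : V), 0 ≤ r → 0 ≤ x → 0 ≤ r • x)
    (hVarch : ∀ x y : V, (∀ n : ℕ, n • x ≤ y) → x ≤ 0)
    (G : AddSubgroup V)
    (hGsup : ∀ a ∈ G, ∀ b ∈ G, a ⊔ b ∈ G)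
    (hGinf : ∀ a ∈ G, ∀ b ∈ G, a ⊓ b ∈ G)
    (hGgen : ∀ S : Submodule ℝ V, (∀ a ∈ S, ∀ b ∈ S, a ⊔ b ∈ S) →
      (∀ a ∈ S, ∀ b ∈ S, a ⊓ b ∈ S) → (∀ g ∈ G, g ∈ S) → ∀ x : V, x ∈ S) :
    ∀ v : V, 0 < v → ∃ g ∈ G, 0 < g ∧ ∃ n : ℕ, g ≤ n • v := by
  have : IsOrderedAddMonoid V :=
    { add_le_add_left := fun a b hab c ↦ hVcov a b c hab }
  have : PosSMulMono ℝ V := ⟨fun r hr x y hxy ↦ by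
    have := hVpos r (y - x) hr (sub_nonneg.2 hxy)
    rwa [smul_sub, sub_nonneg] at this⟩
  intro v hv
  obtain ⟨e, he, he0, h⟩ := hGgen (approximableSubmodule G hGsup)
    (fun a ⟨e, he, he0, ha⟩ b ⟨f, hf, hf0, hb⟩ ↦
      ⟨e + f, G.add_mem he hf, add_nonneg he0 hf0,
        (ha.mono (le_add_of_nonneg_right hf0)).sup hGsup (hb.mono (le_add_of_nonneg_left he0))⟩)
    (fun a ⟨e, he, he0, ha⟩ b ⟨f, hf, hf0, hb⟩ ↦
      ⟨e + f, G.add_mem he hf, add_nonneg he0 hf0,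
        (ha.mono (le_add_of_nonneg_right hf0)).inf hGinf (hb.mono (le_add_of_nonneg_left he0))⟩)
    (fun g hg ↦ ⟨0, G.zero_mem, le_rfl, .of_mem hg⟩) v
  obtain ⟨z, ⟨N, hN, hNz⟩, hz0, hzv⟩ := h.exists_pos_le hVarch hGsup he he0 hv
  exact ⟨N • z, hNz, hz0.trans_le (le_self_nsmul hz0.le hN.ne'), N,
    nsmul_le_nsmul_right hzv N⟩
end

section
/- Let G be an archimedean lattice-ordered abelian group and suppose s₁ and s₂ are two real scalar multiplications on G, each making G (with its given group and lattice structure) into a Riesz space. Then s₁ = s₂, i.e. s₁(r, x) = s₂(r, x) for all r ∈ ℝ and x ∈ G. (Up to isomorphism, an archimedean lattice-ordered abelian group carries at most one Riesz space structure; this is the lattice-group form of the statement that two semisimple Riesz MV-algebras with the same MV-algebra reduct are isomorphic.) -/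
/-- In an archimedean ordered abelian group, two positive additive maps out of `ℝ` which agree
at `1` are comparable at every point. -/
theorem AddMonoidHom.real_apply_le_of_apply_one_eq {G : Type*} [AddCommGroup G] [PartialOrder G]
    [IsOrderedAddMonoid G] (hG : ∀ x y : G, (∀ n : ℕ, n • x ≤ y) → x ≤ 0) {f g : ℝ →+ G}
    (hf : ∀ r, 0 ≤ r → 0 ≤ f r) (hg : ∀ r, 0 ≤ r → 0 ≤ g r) (hfg : f 1 = g 1) (r : ℝ) :
    f r ≤ g r := by
  have hint (h : ℝ →+ G) (k : ℤ) : h k = k • h 1 := by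
    rw [← map_zsmul, zsmul_one]
  refine sub_nonpos.1 (hG _ (f 1) fun n => ?_)
  have hupper : f (n • r) ≤ (⌊n • r⌋ + 1) • f 1 := by
    rw [← hint, ← sub_nonneg, ← map_sub]
    refine hf _ (sub_nonneg.2 ?_)
    push_cast
    exact (Int.lt_floor_add_one _).le
  have hlower : ⌊n • r⌋ • f 1 ≤ g (n • r) := by
    rw [hfg, ← hint, ← sub_nonneg, ← map_sub]
    exact hg _ (sub_nonneg.2 (Int.floor_le _))
  calc n • (f r - g r) = f (n • r) - g (n • r) := by rw [smul_sub, map_nsmul, map_nsmul]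
    _ ≤ (⌊n • r⌋ + 1) • f 1 - ⌊n • r⌋ • f 1 := sub_le_sub hupper hlower
    _ = f 1 := by rw [add_smul, one_smul, add_sub_cancel_left]


/-- `s : ℝ → G → G` is a Riesz scalar multiplication on the lattice-ordered abelian
group `G`: it makes `G` into a real vector space (with its given addition) and
satisfies `0 ≤ r → 0 ≤ x → 0 ≤ s r x`. -/
def IsRieszSMul (G : Type) [Lattice G] [AddCommGroup G] (s : ℝ → G → G) : Prop :=
  (∀ x : G, s 1 x = x) ∧
  (∀ (r : ℝ) (x y : G), s r (x + y) = s r x + s r y) ∧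
  (∀ (r q : ℝ) (x : G), s (r + q) x = s r x + s q x) ∧
  (∀ (r q : ℝ) (x : G), s (r * q) x = s r (s q x)) ∧
  (∀ (r : ℝ) (x : G), 0 ≤ r → 0 ≤ x → 0 ≤ s r x)

/-- An archimedean lattice-ordered abelian group carries at most one Riesz space
structure: any two real scalar multiplications making it a Riesz space coincide. -/
theorem riesz_smul_unique
    (G : Type) [Lattice G] [AddCommGroup G]
    (hGcov : ∀ a b c : G, a ≤ b → a + c ≤ b + c)
    (hGarch : ∀ x y : G, (∀ n : ℕ, n • x ≤ y) → x ≤ 0)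
    (s₁ s₂ : ℝ → G → G)
    (hs₁ : IsRieszSMul G s₁) (hs₂ : IsRieszSMul G s₂) :
    s₁ = s₂ := by
  have : IsOrderedAddMonoid G := { add_le_add_left := fun a b h c => hGcov a b c h }
  obtain ⟨one₁, add₁, add_smul₁, -, nonneg₁⟩ := hs₁
  obtain ⟨one₂, add₂, add_smul₂, -, nonneg₂⟩ := hs₂
  have eq_of_nonneg (r : ℝ) (x : G) (hx : 0 ≤ x) : s₁ r x = s₂ r x := by
    let f : ℝ →+ G := AddMonoidHom.mk' (s₁ · x) fun a b => add_smul₁ a b x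
    let g : ℝ →+ G := AddMonoidHom.mk' (s₂ · x) fun a b => add_smul₂ a b x
    have hf (a : ℝ) (ha : 0 ≤ a) : 0 ≤ f a := nonneg₁ a x ha hx
    have hg (a : ℝ) (ha : 0 ≤ a) : 0 ≤ g a := nonneg₂ a x ha hx
    have hfg : f 1 = g 1 := (one₁ x).trans (one₂ x).symm
    exact le_antisymm (AddMonoidHom.real_apply_le_of_apply_one_eq hGarch hf hg hfg r)
      (AddMonoidHom.real_apply_le_of_apply_one_eq hGarch hg hf hfg.symm r)
  funext r x
  let f : G →+ G := AddMonoidHom.mk' (s₁ r) (add₁ r)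
  let g : G →+ G := AddMonoidHom.mk' (s₂ r) (add₂ r)
  change f x = g x
  rw [← posPart_sub_negPart x, map_sub, map_sub]
  exact congrArg₂ (· - ·) (eq_of_nonneg r _ (posPart_nonneg x))
    (eq_of_nonneg r _ (negPart_nonneg x))
end

section
/- Let G be an archimedean lattice-ordered abelian group with strong unit u, let U be an archimedean Riesz space, and let ι : G → U be an injective essential lattice-group homomorphism such that U is the smallest vector sublattice containing ι(G) and ι(u) is a strong unit of U. Then for every archimedean Riesz space V with strong unit v, the map g ↦ g ∘ ι is a bijection from the set of lattice-group homomorphisms g : U → V with g(ι(u)) = v onto the set of lattice-group homomorphisms f : G → V with f(u) = v. (Hom-set bijection underlying the adjunction between the Riesz hull functor and the forgetful functor.) -/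
lemma real_smul_sup_of_pos {W : Type*} [Lattice W] [AddCommGroup W] [Module ℝ W]
    [IsOrderedModule ℝ W] {r : ℝ} (hr : 0 < r) (x y : W) :
    r • (x ⊔ y) = r • x ⊔ r • y :=
  map_sup (OrderIso.smulRight (β := W) hr) x y

section RationalApproximation

variable {G W : Type*} [AddCommGroup G]
  [Lattice W] [AddCommGroup W] [IsOrderedAddMonoid W] [Module ℝ W]

/-- `x` is a `w`-uniform limit of elements of the rational span of the range of `F`. -/
def IsRationalLimit (F : G →+ W) (w x : W) : Prop :=
  ∀ ε : ℝ, 0 < ε → ∃ (a : G) (m : ℕ), 0 < m ∧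
    x ≤ (m : ℝ)⁻¹ • F a + ε • w ∧ (m : ℝ)⁻¹ • F a ≤ x + ε • w

namespace IsRationalLimit

variable {F : G →+ W} {w x y : W}

lemma neg (hx : IsRationalLimit F w x) : IsRationalLimit F w (-x) := by
  intro ε hε
  obtain ⟨a, m, hm, h₁, h₂⟩ := hx ε hε
  refine ⟨-a, m, hm, ?_, ?_⟩
  · rw [map_neg, smul_neg, ← sub_nonneg]
    convert sub_nonneg.2 h₂ using 1
    abel
  · rw [map_neg, smul_neg, ← sub_nonneg]
    convert sub_nonneg.2 h₁ using 1
    abel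

lemma add (hx : IsRationalLimit F w x) (hy : IsRationalLimit F w y) :
    IsRationalLimit F w (x + y) := by
  intro ε hε
  obtain ⟨a, m, hm, h₁, h₂⟩ := hx (ε / 2) (by positivity)
  obtain ⟨b, k, hk, h₃, h₄⟩ := hy (ε / 2) (by positivity)
  have hm' : (m : ℝ) ≠ 0 := by positivity
  have hk' : (k : ℝ) ≠ 0 := by positivity
  have key : ((m * k : ℕ) : ℝ)⁻¹ • F (k • a + m • b) =
      (m : ℝ)⁻¹ • F a + (k : ℝ)⁻¹ • F b := by
    rw [map_add, map_nsmul, map_nsmul, ← Nat.cast_smul_eq_nsmul ℝ, ← Nat.cast_smul_eq_nsmul ℝ]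
    push_cast
    match_scalars <;> field_simp
  refine ⟨k • a + m • b, m * k, by positivity, ?_, ?_⟩ <;> rw [key]
  · exact (add_le_add h₁ h₃).trans_eq (by module)
  · exact (add_le_add h₂ h₄).trans_eq (by module)

variable [IsOrderedModule ℝ W]

lemma of_mem_range (hw : 0 ≤ w) (a : G) : IsRationalLimit F w (F a) := by
  intro ε hε
  have h : 0 ≤ ε • w := smul_nonneg hε.le hw
  exact ⟨a, 1, one_pos, by simpa using h, by simpa using h⟩

lemma sup [Lattice G] (hF : ∀ a b, F (a ⊔ b) = F a ⊔ F b)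
    (hx : IsRationalLimit F w x) (hy : IsRationalLimit F w y) :
    IsRationalLimit F w (x ⊔ y) := by
  intro ε hε
  obtain ⟨a, m, hm, h₁, h₂⟩ := hx ε hε
  obtain ⟨b, k, hk, h₃, h₄⟩ := hy ε hε
  have hm' : (m : ℝ) ≠ 0 := by positivity
  have hk' : (k : ℝ) ≠ 0 := by positivity
  have key : ((m * k : ℕ) : ℝ)⁻¹ • F (k • a ⊔ m • b) =
      (m : ℝ)⁻¹ • F a ⊔ (k : ℝ)⁻¹ • F b := by
    rw [hF, map_nsmul, map_nsmul, ← Nat.cast_smul_eq_nsmul ℝ, ← Nat.cast_smul_eq_nsmul ℝ,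
      real_smul_sup_of_pos (by positivity)]
    push_cast
    congr 1 <;> match_scalars <;> field_simp
  refine ⟨k • a ⊔ m • b, m * k, by positivity, ?_, ?_⟩ <;> rw [key]
  · exact sup_le (h₁.trans (by gcongr; exact le_sup_left))
      (h₃.trans (by gcongr; exact le_sup_right))
  · exact sup_le (h₂.trans (by gcongr; exact le_sup_left))
      (h₄.trans (by gcongr; exact le_sup_right))

lemma inf [Lattice G] (hF : ∀ a b, F (a ⊔ b) = F a ⊔ F b)
    (hx : IsRationalLimit F w x) (hy : IsRationalLimit F w y) :
    IsRationalLimit F w (x ⊓ y) := by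
  simpa only [neg_sup, neg_neg] using (sup hF hx.neg hy.neg).neg

lemma smul_of_nonneg (hw : 0 ≤ w) (hbdd : ∀ a, ∃ n : ℕ, F a ≤ n • w)
    {r : ℝ} (hr : 0 ≤ r) (hx : IsRationalLimit F w x) : IsRationalLimit F w (r • x) := by
  intro ε hε
  obtain ⟨a, m, hm, h₁, h₂⟩ := hx (ε / 2 / (r + 1)) (by positivity)
  obtain ⟨n₁, hn₁⟩ := hbdd a
  obtain ⟨n₂, hn₂⟩ := hbdd (-a)
  obtain ⟨q, hq⟩ := exists_nat_gt (2 * (n₁ + n₂ : ℝ) / ε)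
  have hq0 : (0 : ℝ) < q := lt_of_le_of_lt (by positivity) hq
  have hm0 : (0 : ℝ) < m := by positivity
  set p := ⌊r * q⌋₊
  have hp₁ : (p : ℝ) ≤ r * q := Nat.floor_le (by positivity)
  have hp₂ : r * q < p + 1 := Nat.lt_floor_add_one _
  have key : ((m * q : ℕ) : ℝ)⁻¹ • F (p • a) = (p / q : ℝ) • (m : ℝ)⁻¹ • F a := by
    rw [map_nsmul, ← Nat.cast_smul_eq_nsmul ℝ]
    push_cast
    match_scalars
    field_simp
  set t : ℝ := (r - p / q) * (m : ℝ)⁻¹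
  have ht0 : 0 ≤ t := mul_nonneg (sub_nonneg.2 (by rwa [div_le_iff₀ hq0])) (by positivity)
  have ht1 : t ≤ 1 / q := by
    have h : r - p / q ≤ 1 / q := by
      rw [sub_le_iff_le_add, ← add_div, le_div_iff₀ hq0]; linarith
    have hm1 : (m : ℝ)⁻¹ ≤ 1 := inv_le_one_of_one_le₀ (by exact_mod_cast hm)
    calc t ≤ 1 / q * 1 := by
          apply mul_le_mul h hm1 <;> positivity
      _ = 1 / q := mul_one _
  have small : ∀ (z : W) (n : ℕ), z ≤ n • w → (n : ℝ) ≤ n₁ + n₂ → t • z ≤ (ε / 2) • w := by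
    intro z n hz hn
    calc t • z ≤ t • (n • w) := smul_le_smul_of_nonneg_left hz ht0
      _ = (t * n) • w := by rw [← Nat.cast_smul_eq_nsmul ℝ, smul_smul]
      _ ≤ (ε / 2) • w := by
        refine smul_le_smul_of_nonneg_right ?_ hw
        calc t * n ≤ 1 / q * (n₁ + n₂) := by
              apply mul_le_mul ht1 hn <;> positivity
          _ ≤ ε / 2 := by
            rw [div_lt_iff₀ hε] at hq
            rw [one_div_mul_eq_div, div_le_iff₀ hq0]
            linarith
  have s₁ := small _ _ hn₁ (by simp)
  have s₂ := small _ _ hn₂ (by simp)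
  have hrε : (r * (ε / 2 / (r + 1))) • w ≤ (ε / 2) • w := by
    refine smul_le_smul_of_nonneg_right ?_ hw
    rw [mul_div_assoc', div_le_iff₀ (by positivity)]
    nlinarith
  refine ⟨p • a, m * q, Nat.mul_pos hm (by exact_mod_cast hq0), ?_, ?_⟩ <;> rw [key]
  · calc r • x ≤ r • ((m : ℝ)⁻¹ • F a + (ε / 2 / (r + 1)) • w) :=
          smul_le_smul_of_nonneg_left h₁ hr
      _ = (p / q : ℝ) • (m : ℝ)⁻¹ • F a + (t • F a + (r * (ε / 2 / (r + 1))) • w) := by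
        simp only [t]; module
      _ ≤ (p / q : ℝ) • (m : ℝ)⁻¹ • F a + ((ε / 2) • w + (ε / 2) • w) := by gcongr
      _ = _ := by module
  · calc (p / q : ℝ) • (m : ℝ)⁻¹ • F a = r • ((m : ℝ)⁻¹ • F a) + t • F (-a) := by
          rw [map_neg]; simp only [t]; module
      _ ≤ r • (x + (ε / 2 / (r + 1)) • w) + (ε / 2) • w :=
        add_le_add (smul_le_smul_of_nonneg_left h₂ hr) s₂
      _ = r • x + ((r * (ε / 2 / (r + 1))) • w + (ε / 2) • w) := by module
      _ ≤ r • x + ((ε / 2) • w + (ε / 2) • w) := by gcongr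
      _ = _ := by module

/-- The rational limits form a linear subspace. -/
def submodule (F : G →+ W) {w : W} (hw : 0 ≤ w) (hbdd : ∀ a, ∃ n : ℕ, F a ≤ n • w) :
    Submodule ℝ W where
  carrier := {x | IsRationalLimit F w x}
  zero_mem' := by simpa using of_mem_range (F := F) hw 0
  add_mem' := add
  smul_mem' r x hx := by
    rcases le_total 0 r with hr | hr
    · exact smul_of_nonneg hw hbdd hr hx
    · simpa using (smul_of_nonneg hw hbdd (neg_nonneg.2 hr) hx).neg

end IsRationalLimit

end RationalApproximation

lemma monotone_of_map_sup {A B : Type*} [SemilatticeSup A] [SemilatticeSup B] {h : A → B}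
    (hsup : ∀ a b, h (a ⊔ b) = h a ⊔ h b) : Monotone h := by
  intro a b hab
  rw [← sup_eq_right, ← hsup, sup_eq_right.2 hab]

section Graph

variable {G U V : Type*} [AddCommGroup G]
  [Lattice U] [AddCommGroup U] [IsOrderedAddMonoid U] [Module ℝ U] [IsOrderedModule ℝ U]
  [Lattice V] [AddCommGroup V] [IsOrderedAddMonoid V] [Module ℝ V] [IsOrderedModule ℝ V]
  {ι : G →+ U} {f : G →+ V} {u : G}

/-- A pair that is a joint rational limit of pairs `(ι a, f a)` respects the order at zero. -/
lemma IsRationalLimit.snd_nonpos [Lattice G] (hι_inj : Function.Injective ι)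
    (hι_sup : ∀ a b, ι (a ⊔ b) = ι a ⊔ ι b) (hf_sup : ∀ a b, f (a ⊔ b) = f a ⊔ f b)
    (hv : 0 ≤ f u) (hVarch : ∀ x y : V, (∀ n : ℕ, n • x ≤ y) → x ≤ 0)
    {x : U} {y : V} (hxy : IsRationalLimit (ι.prod f) (ι u, f u) (x, y)) (hx : x ≤ 0) :
    y ≤ 0 := by
  refine hVarch y (f u) fun n ↦ ?_
  obtain ⟨a, m, hm, ⟨-, h₁⟩, ⟨h₂, -⟩⟩ := hxy ((2 * n + 1 : ℕ) : ℝ)⁻¹ (by positivity)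
  set k : ℕ := 2 * n + 1
  have hm0 : (0 : ℝ) < m := by positivity
  have hk0 : (0 : ℝ) < k := by positivity
  replace h₁ : y ≤ (m : ℝ)⁻¹ • f a + (k : ℝ)⁻¹ • f u := h₁
  replace h₂ : (m : ℝ)⁻¹ • ι a ≤ x + (k : ℝ)⁻¹ • ι u := h₂
  have hι : ι (k • a) ≤ ι (m • u) := by
    have h₃ : (m : ℝ)⁻¹ • ι a ≤ (k : ℝ)⁻¹ • ι u := h₂.trans (by simpa using hx)
    have h₄ := smul_le_smul_of_nonneg_left h₃ (mul_pos hm0 hk0).le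
    rw [map_nsmul, map_nsmul, ← Nat.cast_smul_eq_nsmul ℝ, ← Nat.cast_smul_eq_nsmul ℝ]
    convert h₄ using 1 <;> match_scalars <;> field_simp
  have hG : k • a ≤ m • u := by
    rw [← sup_eq_right]
    exact hι_inj (by rw [hι_sup, sup_eq_right.2 hι])
  have hf : (k : ℝ) • f a ≤ (m : ℝ) • f u := by
    simpa only [map_nsmul, Nat.cast_smul_eq_nsmul] using monotone_of_map_sup hf_sup hG
  have hf' : (m : ℝ)⁻¹ • f a ≤ (k : ℝ)⁻¹ • f u := by
    have h₄ := smul_le_smul_of_nonneg_left hf (inv_pos.2 (mul_pos hm0 hk0)).le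
    convert h₄ using 1 <;> match_scalars <;> field_simp
  calc n • y = (n : ℝ) • y := (Nat.cast_smul_eq_nsmul ℝ n y).symm
    _ ≤ (n : ℝ) • ((k : ℝ)⁻¹ • f u + (k : ℝ)⁻¹ • f u) := by
      refine smul_le_smul_of_nonneg_left (h₁.trans ?_) (by positivity)
      gcongr
    _ = (2 * n / k : ℝ) • f u := by module
    _ ≤ (1 : ℝ) • f u := by
      refine smul_le_smul_of_nonneg_right ?_ hv
      rw [div_le_one hk0]
      simp [k]
    _ = f u := one_smul _ _

/-- If `x` is a rational limit of `ι`, the graph point of `x` under an extension of `f` is a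
joint rational limit. -/
lemma IsRationalLimit.graph {g : U →+ V} (hg_sup : ∀ a b, g (a ⊔ b) = g a ⊔ g b)
    (hgf : ∀ a, g (ι a) = f a) (hu : 0 ≤ ι u) {x : U} (hx : IsRationalLimit ι (ι u) x) :
    IsRationalLimit (ι.prod f) (ι u, f u) (x, g x) := by
  have hg := monotone_of_map_sup hg_sup
  have hv : 0 ≤ f u := by simpa [hgf] using hg hu
  intro ε hε
  obtain ⟨k, hk⟩ := exists_nat_gt ε⁻¹
  have hk0 : (0 : ℝ) < k := lt_trans (by positivity) hk
  have hkε : (k : ℝ)⁻¹ ≤ ε := (inv_lt_of_inv_lt₀ hε hk).le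
  obtain ⟨a, m, hm, h₁, h₂⟩ := hx (k : ℝ)⁻¹ (by positivity)
  have hm0 : (0 : ℝ) < m := by positivity
  have hmk := (mul_pos hm0 hk0).le
  have hmk' := (inv_pos.2 (mul_pos hm0 hk0)).le
  have hιε : (k : ℝ)⁻¹ • ι u ≤ ε • ι u := smul_le_smul_of_nonneg_right hkε hu
  have hfε : (k : ℝ)⁻¹ • f u ≤ ε • f u := smul_le_smul_of_nonneg_right hkε hv
  have e₁ : (m * k) • x ≤ ι (k • a + m • u) := by
    have h := smul_le_smul_of_nonneg_left h₁ hmk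
    simp only [map_add, map_nsmul, ← Nat.cast_smul_eq_nsmul ℝ]
    convert h using 1
    · push_cast; rfl
    · match_scalars <;> field_simp
  have e₂ : ι (k • a) ≤ (m * k) • x + ι (m • u) := by
    have h := smul_le_smul_of_nonneg_left h₂ hmk
    simp only [map_nsmul, ← Nat.cast_smul_eq_nsmul ℝ]
    convert h using 1
    · match_scalars; field_simp
    · push_cast; match_scalars <;> field_simp
  have e₃ : (m * k : ℝ) • g x ≤ (k : ℝ) • f a + (m : ℝ) • f u := by
    have h := hg e₁
    rw [hgf, map_nsmul g, map_add] at h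
    simpa only [map_nsmul, ← Nat.cast_smul_eq_nsmul ℝ, Nat.cast_mul] using h
  have e₄ : (k : ℝ) • f a ≤ (m * k : ℝ) • g x + (m : ℝ) • f u := by
    have h := hg e₂
    rw [map_add, hgf, hgf, map_nsmul g] at h
    simpa only [map_nsmul, ← Nat.cast_smul_eq_nsmul ℝ, Nat.cast_mul] using h
  refine ⟨a, m, hm, ⟨h₁.trans (by simpa using hιε), ?_⟩, ⟨h₂.trans (by simpa using hιε), ?_⟩⟩
  · have h := smul_le_smul_of_nonneg_left e₃ hmk'
    calc g x = (m * k : ℝ)⁻¹ • (m * k : ℝ) • g x := by match_scalars; field_simp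
      _ ≤ _ := h
      _ = (m : ℝ)⁻¹ • f a + (k : ℝ)⁻¹ • f u := by match_scalars <;> field_simp
      _ ≤ (m : ℝ)⁻¹ • f a + ε • f u := by gcongr
  · have h := smul_le_smul_of_nonneg_left e₄ hmk'
    calc (m : ℝ)⁻¹ • f a = (m * k : ℝ)⁻¹ • (k : ℝ) • f a := by match_scalars; field_simp
      _ ≤ _ := h
      _ = g x + (k : ℝ)⁻¹ • f u := by match_scalars <;> field_simp
      _ ≤ g x + ε • f u := by gcongr

end Graph


/-- Hom-set bijection underlying the adjunction between the Riesz hull functor and the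
forgetful functor: composition with `ι` is a bijection from the unital lattice-group
homomorphisms `U → V` onto the unital lattice-group homomorphisms `G → V`. -/
theorem riesz_hull_hom_bijection
    (G : Type) [Lattice G] [AddCommGroup G]
    (hGcov : ∀ a b c : G, a ≤ b → a + c ≤ b + c)
    (hGarch : ∀ x y : G, (∀ n : ℕ, n • x ≤ y) → x ≤ 0)
    (u : G) (hu0 : 0 ≤ u) (hu : ∀ x : G, ∃ n : ℕ, x ≤ n • u)
    (U : Type) [Lattice U] [AddCommGroup U] [Module ℝ U]
    (hUcov : ∀ a b c : U, a ≤ b → a + c ≤ b + c)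
    (hUpos : ∀ (r : ℝ) (x : U), 0 ≤ r → 0 ≤ x → 0 ≤ r • x)
    (hUarch : ∀ x y : U, (∀ n : ℕ, n • x ≤ y) → x ≤ 0)
    (ι : G → U) (hι_inj : Function.Injective ι)
    (hι_add : ∀ a b : G, ι (a + b) = ι a + ι b)
    (hι_sup : ∀ a b : G, ι (a ⊔ b) = ι a ⊔ ι b)
    (hι_ess : ∀ b : U, 0 < b → ∃ a : G, 0 < a ∧ ∃ n : ℕ, ι a ≤ n • b)
    (hι_gen : ∀ S : Submodule ℝ U, (∀ a ∈ S, ∀ b ∈ S, a ⊔ b ∈ S) →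
      (∀ a ∈ S, ∀ b ∈ S, a ⊓ b ∈ S) → (∀ g : G, ι g ∈ S) → ∀ x : U, x ∈ S)
    (hι_unit : 0 ≤ ι u) (hι_strong : ∀ x : U, ∃ n : ℕ, x ≤ n • ι u)
    (V : Type) [Lattice V] [AddCommGroup V] [Module ℝ V]
    (hVcov : ∀ a b c : V, a ≤ b → a + c ≤ b + c)
    (hVpos : ∀ (r : ℝ) (x : V), 0 ≤ r → 0 ≤ x → 0 ≤ r • x)
    (hVarch : ∀ x y : V, (∀ n : ℕ, n • x ≤ y) → x ≤ 0)
    (v : V) (hv0 : 0 ≤ v) (hv : ∀ x : V, ∃ n : ℕ, x ≤ n • v) :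
    Set.BijOn (fun g : U → V => g ∘ ι)
      {g : U → V | (∀ a b : U, g (a + b) = g a + g b) ∧
        (∀ a b : U, g (a ⊔ b) = g a ⊔ g b) ∧ g (ι u) = v}
      {f : G → V | (∀ a b : G, f (a + b) = f a + f b) ∧
        (∀ a b : G, f (a ⊔ b) = f a ⊔ f b) ∧ f u = v} := by
  have : IsOrderedAddMonoid U := { add_le_add_left := fun a b h c ↦ hUcov a b c h }
  have : IsOrderedAddMonoid V := { add_le_add_left := fun a b h c ↦ hVcov a b c h }
  have : IsOrderedModule ℝ U := .of_smul_nonneg fun r hr x hx ↦ hUpos r x hr hx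
  have : IsOrderedModule ℝ V := .of_smul_nonneg fun r hr x hx ↦ hVpos r x hr hx
  have : IsOrderedModule ℝ (U × V) := {}
  let j : G →+ U := AddMonoidHom.mk' ι hι_add
  have graph_unique : ∀ f : G →+ V, (∀ a b, f (a ⊔ b) = f a ⊔ f b) → 0 ≤ f u →
      ∀ x y y', IsRationalLimit (j.prod f) (j u, f u) (x, y) →
        IsRationalLimit (j.prod f) (j u, f u) (x, y') → y = y' := by
    intro f hf hfu x y y' h h'
    have hle : ∀ z z', IsRationalLimit (j.prod f) (j u, f u) (x, z) →
        IsRationalLimit (j.prod f) (j u, f u) (x, z') → z ≤ z' := by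
      intro z z' hz hz'
      have hd := hz.add hz'.neg
      simp only [Prod.neg_mk, Prod.mk_add_mk, add_neg_cancel, ← sub_eq_add_neg] at hd
      exact sub_nonpos.1 (hd.snd_nonpos hι_inj hι_sup hf hfu hVarch le_rfl)
    exact le_antisymm (hle _ _ h h') (hle _ _ h' h)
  refine ⟨?_, ?_, ?_⟩
  · rintro g ⟨hg_add, hg_sup, hgu⟩
    exact ⟨fun a b ↦ by simp [hι_add, hg_add], fun a b ↦ by simp [hι_sup, hg_sup], hgu⟩
  · rintro g ⟨hg_add, hg_sup, hgu⟩ g' ⟨hg'_add, hg'_sup, hg'u⟩ hgg'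
    have hbdd : ∀ a, ∃ n : ℕ, j a ≤ n • j u := fun a ↦ hι_strong (ι a)
    let g₁ : U →+ V := AddMonoidHom.mk' g hg_add
    let g₂ : U →+ V := AddMonoidHom.mk' g' hg'_add
    let f : G →+ V := g₁.comp j
    have hfu : 0 ≤ f u := hv0.trans_eq hgu.symm
    funext x
    have hx : IsRationalLimit j (j u) x :=
      hι_gen (IsRationalLimit.submodule j hι_unit hbdd)
        (fun _ ha _ hb ↦ IsRationalLimit.sup hι_sup ha hb)
        (fun _ ha _ hb ↦ IsRationalLimit.inf hι_sup ha hb)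
        (fun a ↦ IsRationalLimit.of_mem_range (F := j) hι_unit a) x
    exact graph_unique f (fun a b ↦ by simp [f, g₁, j, hι_sup, hg_sup]) hfu x _ _
      (hx.graph (g := g₁) hg_sup (fun _ ↦ rfl) hι_unit)
      (hx.graph (g := g₂) hg'_sup (fun a ↦ (congrFun hgg' a).symm) hι_unit)
  · rintro f₀ ⟨hf_add, hf_sup, rfl⟩
    let f : G →+ V := AddMonoidHom.mk' f₀ hf_add
    let F : G →+ U × V := j.prod f
    have hw : (0 : U × V) ≤ (j u, f u) := ⟨hι_unit, hv0⟩
    have hF_sup : ∀ a b, F (a ⊔ b) = F a ⊔ F b := fun a b ↦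
      Prod.ext (hι_sup a b) (hf_sup a b)
    have hbdd : ∀ a, ∃ n : ℕ, F a ≤ n • (j u, f u) := by
      intro a
      obtain ⟨n, hn⟩ := hu a
      refine ⟨n, (monotone_of_map_sup hF_sup hn).trans_eq ?_⟩
      rw [map_nsmul]
      rfl
    have total : ∀ x : U, ∃ y : V, IsRationalLimit F (j u, f u) (x, y) := by
      intro x
      have hx := hι_gen ((IsRationalLimit.submodule F hw hbdd).map (LinearMap.fst ℝ U V))
        (by
          rintro _ ⟨p, hp, rfl⟩ _ ⟨q, hq, rfl⟩
          exact ⟨p ⊔ q, IsRationalLimit.sup hF_sup hp hq, rfl⟩)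
        (by
          rintro _ ⟨p, hp, rfl⟩ _ ⟨q, hq, rfl⟩
          exact ⟨p ⊓ q, IsRationalLimit.inf hF_sup hp hq, rfl⟩)
        (fun a ↦ ⟨F a, IsRationalLimit.of_mem_range hw a, rfl⟩) x
      obtain ⟨⟨x, y⟩, hp, rfl⟩ := hx
      exact ⟨y, hp⟩
    choose g hg using total
    have unique := graph_unique f hf_sup hv0
    have hgf : ∀ a, g (ι a) = f₀ a := fun a ↦
      unique _ _ _ (hg (ι a)) (IsRationalLimit.of_mem_range (F := F) hw a)
    exact ⟨g, ⟨fun a b ↦ unique _ _ _ (hg (a + b)) ((hg a).add (hg b)),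
      fun a b ↦ unique _ _ _ (hg (a ⊔ b)) ((hg a).sup hF_sup (hg b)), hgf u⟩, funext hgf⟩
end

section
/- Let E and F be archimedean Riesz spaces with strong units u and v respectively, and let f : E → F be a lattice-group homomorphism with f(u) = v. Then f is ℝ-linear: f(r • x) = r • f(x) for all r ∈ ℝ and x ∈ E. (Archimedean lattice-group form of: any MV-homomorphism between Riesz MV-algebras automatically preserves the scalar multiplication.) -/
/-- A monotone additive map into an archimedean ordered real vector space commutes with
real scalars on positive elements. -/
theorem AddMonoidHom.map_real_smul_of_nonneg {E F : Type*}
    [AddCommGroup E] [PartialOrder E] [Module ℝ E] [SMulPosMono ℝ E]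
    [AddCommGroup F] [PartialOrder F] [IsOrderedAddMonoid F] [Module ℝ F] [SMulPosMono ℝ F]
    (harch : ∀ x y : F, (∀ n : ℕ, n • x ≤ y) → x ≤ 0)
    (f : E →+ F) (hf : Monotone f) (r : ℝ) {x : E} (hx : 0 ≤ x) :
    f (r • x) = r • f x := by
  have hfx : 0 ≤ f x := by simpa using hf hx
  have lower (n : ℕ) : (⌊n * r⌋ : ℝ) ≤ n * r := Int.floor_le _
  have upper (n : ℕ) : n * r ≤ ((⌊n * r⌋ + 1 : ℤ) : ℝ) := by
    push_cast; exact (Int.lt_floor_add_one _).le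
  have bounds (n : ℕ) : ⌊n * r⌋ • f x ≤ n • (r • f x) ∧
      n • (r • f x) ≤ (⌊n * r⌋ + 1) • f x := by
    rw [← Nat.cast_smul_eq_nsmul ℝ, smul_smul, ← Int.cast_smul_eq_zsmul ℝ, ← Int.cast_smul_eq_zsmul ℝ]
    exact ⟨smul_le_smul_of_nonneg_right (lower n) hfx,
      smul_le_smul_of_nonneg_right (upper n) hfx⟩
  have map_bounds (n : ℕ) : ⌊n * r⌋ • f x ≤ n • f (r • x) ∧
      n • f (r • x) ≤ (⌊n * r⌋ + 1) • f x := by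
    rw [← map_zsmul, ← map_zsmul, ← map_nsmul, ← Nat.cast_smul_eq_nsmul ℝ, smul_smul,
      ← Int.cast_smul_eq_zsmul ℝ, ← Int.cast_smul_eq_zsmul ℝ]
    exact ⟨hf (smul_le_smul_of_nonneg_right (lower n) hx),
      hf (smul_le_smul_of_nonneg_right (upper n) hx)⟩
  apply le_antisymm
  · refine sub_nonpos.mp (harch _ (f x) fun n => ?_)
    rw [smul_sub, sub_le_iff_le_add']
    refine (map_bounds n).2.trans ?_
    rw [add_smul, one_smul]
    exact add_le_add_left (bounds n).1 _
  · refine sub_nonpos.mp (harch _ (f x) fun n => ?_)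
    rw [smul_sub, sub_le_iff_le_add']
    refine (bounds n).2.trans ?_
    rw [add_smul, one_smul]
    exact add_le_add_left (map_bounds n).1 _

/-- In an ordered additive group, nonnegativity of products of nonnegative scalars and vectors
gives monotonicity in the scalar. -/
theorem SMulPosMono.of_forall_smul_nonneg {E : Type*}
    [AddCommGroup E] [PartialOrder E] [IsOrderedAddMonoid E] [Module ℝ E]
    (hpos : ∀ (r : ℝ) (x : E), 0 ≤ r → 0 ≤ x → 0 ≤ r • x) : SMulPosMono ℝ E where
  smul_le_smul_of_nonneg_right x hx r s hrs := by
    rw [← sub_nonneg, ← sub_smul]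
    exact hpos _ _ (sub_nonneg.mpr hrs) hx

/-- A unital lattice-group homomorphism between archimedean Riesz spaces with strong
units is automatically `ℝ`-linear. -/
theorem unital_lattice_hom_is_linear
    (E : Type) [Lattice E] [AddCommGroup E] [Module ℝ E]
    (hEcov : ∀ a b c : E, a ≤ b → a + c ≤ b + c)
    (hEpos : ∀ (r : ℝ) (x : E), 0 ≤ r → 0 ≤ x → 0 ≤ r • x)
    (hEarch : ∀ x y : E, (∀ n : ℕ, n • x ≤ y) → x ≤ 0)
    (u : E) (hu0 : 0 ≤ u) (hu : ∀ x : E, ∃ n : ℕ, x ≤ n • u)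
    (F : Type) [Lattice F] [AddCommGroup F] [Module ℝ F]
    (hFcov : ∀ a b c : F, a ≤ b → a + c ≤ b + c)
    (hFpos : ∀ (r : ℝ) (x : F), 0 ≤ r → 0 ≤ x → 0 ≤ r • x)
    (hFarch : ∀ x y : F, (∀ n : ℕ, n • x ≤ y) → x ≤ 0)
    (v : F) (hv0 : 0 ≤ v) (hv : ∀ x : F, ∃ n : ℕ, x ≤ n • v)
    (f : E → F)
    (hf_add : ∀ a b : E, f (a + b) = f a + f b)
    (hf_sup : ∀ a b : E, f (a ⊔ b) = f a ⊔ f b)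
    (hfu : f u = v) :
    ∀ (r : ℝ) (x : E), f (r • x) = r • f x := by
  have : IsOrderedAddMonoid E := { add_le_add_left := fun a b hab c => hEcov a b c hab }
  have : IsOrderedAddMonoid F := { add_le_add_left := fun a b hab c => hFcov a b c hab }
  have := SMulPosMono.of_forall_smul_nonneg hEpos
  have := SMulPosMono.of_forall_smul_nonneg hFpos
  let φ : E →+ F := AddMonoidHom.mk' f hf_add
  have hφ : Monotone φ := fun a b hab => by
    change f a ≤ f b
    rw [← sup_eq_right, ← hf_sup, sup_eq_right.mpr hab]
  intro r x
  change φ (r • x) = r • φ x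
  have hpos := φ.map_real_smul_of_nonneg hFarch hφ r (le_sup_right : 0 ≤ x ⊔ 0)
  have hneg := φ.map_real_smul_of_nonneg hFarch hφ r
    (sub_nonneg.mpr (le_sup_left : x ≤ x ⊔ 0))
  simpa [smul_sub, hpos] using hneg
end

section
/- Let Ĝ be a lattice-ordered abelian group that is Dedekind complete (every nonempty subset bounded above has a supremum) and carries a ℚ-vector space structure compatible with the group structure and such that q ≥ 0 and x ≥ 0 imply q • x ≥ 0. Then there exists a real scalar multiplication on Ĝ extending the ℚ-scalar multiplication and making Ĝ a Riesz space, and it satisfies r • a = sup{ q • a : q ∈ ℚ, 0 ≤ q ≤ r } for all r ≥ 0 in ℝ and all a ≥ 0 in Ĝ. (The Dedekind–MacNeille completion of a divisible archimedean lattice-ordered abelian group is a Riesz space; lattice-group form of: the Dedekind–MacNeille completion of a semisimple divisible MV-algebra is a Riesz MV-algebra.) -/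
section RealSMulApprox

variable {G : Type*} [Lattice G] [AddCommGroup G] [IsOrderedAddMonoid G] [Module ℚ G]

/-- In a Dedekind complete lattice-ordered `ℚ`-vector space, an element below all positive rational
multiples of a fixed element is nonpositive. -/
theorem nonpos_of_forall_le_ratSMul [PosSMulMono ℚ G]
    (hG : ∀ S : Set G, S.Nonempty → BddAbove S → ∃ b : G, IsLUB S b) {x a : G}
    (h : ∀ ε : ℚ, 0 < ε → x ≤ ε • a) : x ≤ 0 := by
  have hn : ∀ n : ℕ, ((n : ℚ) + 1) • x ≤ a := fun n => by
    have hpos : (0 : ℚ) < n + 1 := by positivity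
    have := smul_le_smul_of_nonneg_left (h ((n : ℚ) + 1)⁻¹ (inv_pos.2 hpos)) hpos.le
    rwa [smul_smul, mul_inv_cancel₀ hpos.ne', one_smul] at this
  obtain ⟨b, hb⟩ := hG (Set.range fun n : ℕ => ((n : ℚ) + 1) • x) (Set.range_nonempty _)
    ⟨a, by rintro _ ⟨n, rfl⟩; exact hn n⟩
  have hle : b ≤ b - x := hb.2 <| by
    rintro _ ⟨n, rfl⟩
    have := hb.1 ⟨n + 1, rfl⟩
    rw [le_sub_iff_add_le]
    simpa [add_smul] using this
  simpa using hle

/-- `y` lies between all rational multiples `p • a` and `q • a` with `p < r < q`. -/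
def IsRealSMulApprox (r : ℝ) (a y : G) : Prop :=
  (∀ p : ℚ, (p : ℝ) < r → p • a ≤ y) ∧ ∀ q : ℚ, r < q → y ≤ q • a

theorem ratSMul_le_ratSMul_of_nonneg [PosSMulMono ℚ G] {p q : ℚ} (hpq : p ≤ q) {a : G}
    (ha : 0 ≤ a) : p • a ≤ q • a := by
  have := smul_nonneg (sub_nonneg.2 hpq) ha
  rwa [sub_smul, sub_nonneg] at this

namespace IsRealSMulApprox

theorem le [PosSMulMono ℚ G]
    (hG : ∀ S : Set G, S.Nonempty → BddAbove S → ∃ b : G, IsLUB S b)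
    {r : ℝ} {a y z : G} (hy : IsRealSMulApprox r a y) (hz : IsRealSMulApprox r a z) : y ≤ z := by
  rw [← sub_nonpos]
  refine nonpos_of_forall_le_ratSMul hG (a := a) fun ε hε => ?_
  have hε' : (0 : ℝ) < ε := by exact_mod_cast hε
  obtain ⟨p, hp, hpr⟩ := exists_rat_btwn (sub_lt_self r hε')
  have h₁ := hz.1 p hpr
  have h₂ := hy.2 (p + ε) (by push_cast; linarith)
  rw [add_smul] at h₂
  rw [sub_le_iff_le_add']
  exact h₂.trans (add_le_add_left h₁ _)

theorem eq [PosSMulMono ℚ G]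
    (hG : ∀ S : Set G, S.Nonempty → BddAbove S → ∃ b : G, IsLUB S b)
    {r : ℝ} {a y z : G} (hy : IsRealSMulApprox r a y) (hz : IsRealSMulApprox r a z) : y = z :=
  le_antisymm (hy.le hG hz) (hz.le hG hy)

theorem exists_of_nonneg [PosSMulMono ℚ G]
    (hG : ∀ S : Set G, S.Nonempty → BddAbove S → ∃ b : G, IsLUB S b)
    (r : ℝ) {a : G} (ha : 0 ≤ a) : ∃ y, IsRealSMulApprox r a y := by
  have hub : ∀ q : ℚ, r < q → q • a ∈ upperBounds {y : G | ∃ p : ℚ, (p : ℝ) < r ∧ p • a = y} := by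
    rintro q hq _ ⟨p, hp, rfl⟩
    exact ratSMul_le_ratSMul_of_nonneg (by exact_mod_cast (hp.trans hq).le) ha
  obtain ⟨p, hp⟩ := exists_rat_lt r
  obtain ⟨q, hq⟩ := exists_rat_gt r
  obtain ⟨y, hy⟩ := hG {y : G | ∃ p : ℚ, (p : ℝ) < r ∧ p • a = y}
    ⟨_, p, hp, rfl⟩ ⟨_, hub q hq⟩
  exact ⟨y, fun p hp => hy.1 ⟨p, hp, rfl⟩, fun q hq => hy.2 (hub q hq)⟩

theorem ratCast [PosSMulMono ℚ G] (q : ℚ) {a : G} (ha : 0 ≤ a) :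
    IsRealSMulApprox (q : ℝ) a (q • a) :=
  ⟨fun _ hp => ratSMul_le_ratSMul_of_nonneg (by exact_mod_cast hp.le) ha,
    fun _ hp => ratSMul_le_ratSMul_of_nonneg (by exact_mod_cast hp.le) ha⟩

theorem add_right {r : ℝ} {a b y z : G} (hy : IsRealSMulApprox r a y)
    (hz : IsRealSMulApprox r b z) : IsRealSMulApprox r (a + b) (y + z) :=
  ⟨fun p hp => by rw [smul_add]; exact add_le_add (hy.1 p hp) (hz.1 p hp),
    fun q hq => by rw [smul_add]; exact add_le_add (hy.2 q hq) (hz.2 q hq)⟩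

theorem add_left {r t : ℝ} {a y z : G} (hy : IsRealSMulApprox r a y)
    (hz : IsRealSMulApprox t a z) : IsRealSMulApprox (r + t) a (y + z) := by
  constructor
  · intro p hp
    obtain ⟨u, hu, hur⟩ := exists_rat_btwn (sub_lt_iff_lt_add.2 hp)
    have := add_le_add (hy.1 u hur) (hz.1 (p - u) (by push_cast; linarith))
    rwa [← add_smul, add_sub_cancel] at this
  · intro q hq
    obtain ⟨u, hu, huq⟩ := exists_rat_btwn (lt_sub_iff_add_lt.2 hq)
    have := add_le_add (hy.2 u hu) (hz.2 (q - u) (by push_cast; linarith))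
    rwa [← add_smul, add_sub_cancel] at this

theorem nonneg [PosSMulMono ℚ G]
    (hG : ∀ S : Set G, S.Nonempty → BddAbove S → ∃ b : G, IsLUB S b)
    {r : ℝ} (hr : 0 ≤ r) {a y : G} (ha : 0 ≤ a) (hy : IsRealSMulApprox r a y) : 0 ≤ y := by
  rcases hr.eq_or_lt with rfl | hr
  · have := ratCast (G := G) 0 ha
    rw [Rat.cast_zero, zero_smul] at this
    exact this.le hG hy
  · simpa using hy.1 0 (by simpa using hr)

theorem mul [PosSMulMono ℚ G]
    (hG : ∀ S : Set G, S.Nonempty → BddAbove S → ∃ b : G, IsLUB S b)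
    {r t : ℝ} (hr : 0 < r) (ht : 0 < t) {a y z : G} (ha : 0 ≤ a)
    (hy : IsRealSMulApprox t a y) (hz : IsRealSMulApprox r y z) :
    IsRealSMulApprox (r * t) a z := by
  constructor
  · intro p hp
    rcases le_or_gt p 0 with hp0 | hp0
    · have h := ratSMul_le_ratSMul_of_nonneg hp0 ha
      rw [zero_smul] at h
      exact h.trans (hz.nonneg hG hr.le (hy.nonneg hG ht.le ha))
    obtain ⟨u, hu, hur⟩ := exists_rat_btwn ((div_lt_iff₀ ht).2 hp)
    have hp0' : (0 : ℝ) < p := by exact_mod_cast hp0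
    have hu0' : (0 : ℝ) < u := (div_pos hp0' ht).trans hu
    have hu0 : 0 < u := by exact_mod_cast hu0'
    have hpu := hy.1 (p / u) (by
      push_cast; rw [div_lt_iff₀ hu0']; rwa [div_lt_iff₀ ht, mul_comm] at hu)
    have := smul_le_smul_of_nonneg_left hpu hu0.le
    rw [smul_smul, mul_div_cancel₀ p hu0.ne'] at this
    exact this.trans (hz.1 u hur)
  · intro q hq
    obtain ⟨u, hru, hu⟩ := exists_rat_btwn ((lt_div_iff₀ ht).2 hq)
    have hu0' : (0 : ℝ) < u := hr.trans hru
    have hu0 : 0 < u := by exact_mod_cast hu0'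
    have hqu := hy.2 (q / u) (by
      push_cast; rw [lt_div_iff₀ hu0']; rwa [lt_div_iff₀ ht, mul_comm] at hu)
    have := smul_le_smul_of_nonneg_left hqu hu0.le
    rw [smul_smul, mul_div_cancel₀ q hu0.ne'] at this
    exact (hz.2 u hru).trans this

end IsRealSMulApprox

/-- An additive function on the positive cone of a lattice-ordered group extends to a group
homomorphism. -/
theorem exists_addMonoidHom_extend_nonneg {G H : Type*} [Lattice G] [AddCommGroup G]
    [IsOrderedAddMonoid G] [AddCommGroup H] (f : G → H)
    (hf : ∀ a b, 0 ≤ a → 0 ≤ b → f (a + b) = f a + f b) :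
    ∃ F : G →+ H, ∀ a, 0 ≤ a → F a = f a := by
  have key : ∀ u v x : G, 0 ≤ u → 0 ≤ v → x = u - v → f x⁺ - f x⁻ = f u - f v := by
    intro u v x hu hv hx
    have h : x⁺ + v = u + x⁻ := by
      rw [← sub_eq_sub_iff_add_eq_add, posPart_sub_negPart, hx]
    have h' := congrArg f h
    rw [hf _ _ (posPart_nonneg x) hv, hf _ _ hu (negPart_nonneg x)] at h'
    rwa [sub_eq_sub_iff_add_eq_add]
  have hf0 : f 0 = 0 := by simpa using hf 0 0 le_rfl le_rfl
  refine ⟨AddMonoidHom.mk' (fun x => f x⁺ - f x⁻) fun x y => ?_, fun a ha => ?_⟩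
  · rw [key (x⁺ + y⁺) (x⁻ + y⁻) (x + y) (add_nonneg (posPart_nonneg x) (posPart_nonneg y))
      (add_nonneg (negPart_nonneg x) (negPart_nonneg y)),
      hf _ _ (posPart_nonneg x) (posPart_nonneg y), hf _ _ (negPart_nonneg x) (negPart_nonneg y)]
    · abel
    · rw [add_sub_add_comm, posPart_sub_negPart, posPart_sub_negPart]
  · simpa [hf0] using key a 0 a ha le_rfl (sub_zero a).symm

theorem addMonoidHom_ext_of_nonneg {G H : Type*} [Lattice G] [AddCommGroup G]
    [IsOrderedAddMonoid G] [AddCommGroup H] {F F' : G →+ H}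
    (h : ∀ a, 0 ≤ a → F a = F' a) : F = F' := by
  ext x
  rw [← posPart_sub_negPart x, map_sub, map_sub, h _ (posPart_nonneg x), h _ (negPart_nonneg x)]

theorem exists_addMonoidHom_isRealSMulApprox [PosSMulMono ℚ G]
    (hG : ∀ S : Set G, S.Nonempty → BddAbove S → ∃ b : G, IsLUB S b) :
    ∃ s : ℝ →+ G →+ G, ∀ r a, 0 ≤ a → IsRealSMulApprox r a (s r a) := by
  have h : ∀ r : ℝ, ∃ F : G →+ G, ∀ a, 0 ≤ a → IsRealSMulApprox r a (F a) := by
    intro r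
    choose! f hf using fun a (ha : (0 : G) ≤ a) =>
      IsRealSMulApprox.exists_of_nonneg hG r ha
    obtain ⟨F, hF⟩ := exists_addMonoidHom_extend_nonneg f fun a b ha hb =>
      (hf _ (add_nonneg ha hb)).eq hG ((hf a ha).add_right (hf b hb))
    exact ⟨F, fun a ha => by rw [hF a ha]; exact hf a ha⟩
  choose F hF using h
  exact ⟨AddMonoidHom.mk' F fun r t => addMonoidHom_ext_of_nonneg fun a ha =>
    (hF (r + t) a ha).eq hG ((hF r a ha).add_left (hF t a ha)), hF⟩

theorem map_mul_of_isRealSMulApprox [PosSMulMono ℚ G]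
    (hG : ∀ S : Set G, S.Nonempty → BddAbove S → ∃ b : G, IsLUB S b)
    {s : ℝ →+ G →+ G} (hs : ∀ r a, 0 ≤ a → IsRealSMulApprox r a (s r a)) (r t : ℝ) :
    s (r * t) = (s r).comp (s t) := by
  have hpos : ∀ r t : ℝ, 0 ≤ r → 0 ≤ t → s (r * t) = (s r).comp (s t) := by
    intro r t hr ht
    rcases hr.eq_or_lt with rfl | hr
    · ext; simp
    rcases ht.eq_or_lt with rfl | ht
    · ext; simp
    refine addMonoidHom_ext_of_nonneg fun a ha => ?_
    have hy := hs t a ha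
    exact (hs (r * t) a ha).eq hG (hy.mul hG hr ht ha (hs r _ (hy.nonneg hG ht.le ha)))
  ext x
  have hx : ∀ r t : ℝ, 0 ≤ r → 0 ≤ t → s (r * t) x = s r (s t x) := fun r t hr ht =>
    DFunLike.congr_fun (hpos r t hr ht) x
  rcases le_total 0 r with hr | hr <;> rcases le_total 0 t with ht | ht
  · exact hx r t hr ht
  · simpa using hx r (-t) hr (neg_nonneg.2 ht)
  · simpa using hx (-r) t (neg_nonneg.2 hr) ht
  · simpa using hx (-r) (-t) (neg_nonneg.2 hr) (neg_nonneg.2 ht)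

theorem isLUB_ratSMul_of_isRealSMulApprox [PosSMulMono ℚ G]
    (hG : ∀ S : Set G, S.Nonempty → BddAbove S → ∃ b : G, IsLUB S b)
    {r : ℝ} (hr : 0 ≤ r) {a y : G} (ha : 0 ≤ a) (hy : IsRealSMulApprox r a y) :
    IsLUB {x : G | ∃ q : ℚ, 0 ≤ q ∧ (q : ℝ) ≤ r ∧ x = q • a} y := by
  constructor
  · rintro _ ⟨q, -, hqr, rfl⟩
    rcases hqr.eq_or_lt with rfl | hqr
    · exact (IsRealSMulApprox.ratCast q ha).le hG hy
    · exact hy.1 q hqr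
  · intro u hu
    rw [← sub_nonpos]
    refine nonpos_of_forall_le_ratSMul hG (a := a) fun ε hε => ?_
    have hε' : (0 : ℝ) < ε := by exact_mod_cast hε
    obtain ⟨p, hp, hpr⟩ := exists_rat_btwn (sub_lt_self r hε')
    have h₁ : max p 0 • a ≤ u := hu ⟨max p 0, le_max_right _ _, by
      push_cast; exact max_le hpr.le hr, rfl⟩
    have h₂ := hy.2 (max p 0 + ε) (by
      push_cast; linarith [le_max_left (p : ℝ) 0])
    rw [add_smul] at h₂
    rw [sub_le_iff_le_add']
    exact h₂.trans (add_le_add_left h₁ _)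

end RealSMulApprox


/-- A Dedekind complete lattice-ordered abelian group carrying a compatible positive
`ℚ`-scalar multiplication admits a real scalar multiplication extending it and making it
a Riesz space, the scalar multiplication being given by
`r • a = sup { q • a : q ∈ ℚ, 0 ≤ q ≤ r }` for `r ≥ 0` and `a ≥ 0`. -/
theorem dedekind_complete_divisible_is_riesz
    (G : Type) [Lattice G] [AddCommGroup G]
    (hGcov : ∀ a b c : G, a ≤ b → a + c ≤ b + c)
    (hGcomplete : ∀ S : Set G, S.Nonempty → BddAbove S → ∃ b : G, IsLUB S b)
    (qs : ℚ → G → G)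
    (hq_one : ∀ x : G, qs 1 x = x)
    (hq_add : ∀ (q : ℚ) (x y : G), qs q (x + y) = qs q x + qs q y)
    (hq_add' : ∀ (q r : ℚ) (x : G), qs (q + r) x = qs q x + qs r x)
    (hq_mul : ∀ (q r : ℚ) (x : G), qs (q * r) x = qs q (qs r x))
    (hq_pos : ∀ (q : ℚ) (x : G), 0 ≤ q → 0 ≤ x → 0 ≤ qs q x) :
    ∃ s : ℝ → G → G,
      (∀ x : G, s 1 x = x) ∧
      (∀ (r : ℝ) (x y : G), s r (x + y) = s r x + s r y) ∧
      (∀ (r r' : ℝ) (x : G), s (r + r') x = s r x + s r' x) ∧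
      (∀ (r r' : ℝ) (x : G), s (r * r') x = s r (s r' x)) ∧
      (∀ (r : ℝ) (x : G), 0 ≤ r → 0 ≤ x → 0 ≤ s r x) ∧
      (∀ (q : ℚ) (x : G), s (q : ℝ) x = qs q x) ∧
      (∀ (r : ℝ) (a : G), 0 ≤ r → 0 ≤ a →
        IsLUB {y : G | ∃ q : ℚ, 0 ≤ q ∧ (q : ℝ) ≤ r ∧ y = qs q a} (s r a)) := by
  have : IsOrderedAddMonoid G := { add_le_add_left := fun a b h c => hGcov a b c h }
  let _ : Module ℚ G :=
    { smul := qs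
      one_smul := hq_one
      mul_smul := hq_mul
      smul_zero := fun q => (by simpa using hq_add q 0 0 : qs q 0 = 0)
      smul_add := hq_add
      add_smul := hq_add'
      zero_smul := fun x => (by simpa using hq_add' 0 0 x : qs 0 x = 0) }
  have : PosSMulMono ℚ G := PosSMulMono.of_smul_nonneg fun q hq x hx => hq_pos q x hq hx
  obtain ⟨s, hs⟩ := exists_addMonoidHom_isRealSMulApprox hGcomplete
  have hrat : ∀ (q : ℚ) (x : G), s (q : ℝ) x = qs q x := fun q x =>
    DFunLike.congr_fun (addMonoidHom_ext_of_nonneg (F' := DistribSMul.toAddMonoidHom G q)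
      fun a ha => (hs q a ha).eq hGcomplete (IsRealSMulApprox.ratCast q ha)) x
  refine ⟨fun r x => s r x, fun x => ?_, fun r => map_add (s r), fun r t x => by simp,
    fun r t x => ?_, fun r x hr hx => (hs r x hx).nonneg hGcomplete hr hx, hrat,
    fun r a hr ha => isLUB_ratSMul_of_isRealSMulApprox hGcomplete hr ha (hs r a ha)⟩
  · simpa [hq_one] using hrat 1 x
  · exact DFunLike.congr_fun (map_mul_of_isRealSMulApprox hGcomplete hs r t) x
end
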